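/- Let m, d > 1 be integers, and let r₁, r₂ be nonnegative integers with r₁ + 2r₂ = d. There exist infinitely many (isomorphism classes of) number fields k with [k:ℚ] = d, having exactly r₁ real places and r₂ complex places, such that rank_m Cl(k) ≥ r₂. -/

import Mathlib

open NumberField

/-- Let `Φ : ℤⁿ → A` be killed by `m`, and suppose `ker Φ` lifts to a subgroup `G` of `ℤⁿ × ℤʳ`
whose elements `(e, 0)` all satisfy `m ∣ e`. Then `(ℤ/m)ⁿ⁻ʳ` embeds into `A`. -/
theorem exists_injective_of_kernel_lift {A : Type*} [AddCommGroup A] {m n r k : ℕ}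
    (hk : k + r ≤ n) (Φ : (Fin n → ℤ) →+ A) (hΦ : ∀ v, m • Φ v = 0)
    (G : AddSubgroup ((Fin n → ℤ) × (Fin r → ℤ)))
    (h1 : ∀ e, Φ e = 0 → ∃ c, (e, c) ∈ G)
    (h2 : ∀ e, (e, (0 : Fin r → ℤ)) ∈ G → ∀ i, (m : ℤ) ∣ e i) :
    ∃ f : (Fin k → ZMod m) →+ A, Function.Injective f := by
  classical
  let G' : Submodule ℤ ((Fin n → ℤ) × (Fin r → ℤ)) := AddSubgroup.toIntSubmodule G
  let π : ((Fin n → ℤ) × (Fin r → ℤ)) →ₗ[ℤ] (Fin r → ℤ) := LinearMap.snd ℤ _ _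
  let G2 : Submodule ℤ (Fin r → ℤ) := G'.map π
  obtain ⟨t, ⟨b⟩⟩ := Submodule.nonempty_basis_of_pid (Pi.basisFun ℤ (Fin r)) G2
  have htr : t ≤ r := by
    have := Submodule.finrank_le G2
    rwa [Module.finrank_eq_card_basis b, Fintype.card_fin, Module.finrank_fin_fun] at this
  have hb : ∀ i, ∃ g : (Fin n → ℤ) × (Fin r → ℤ), g ∈ G ∧ g.2 = b i := by
    intro i
    obtain ⟨g, hg, hgi⟩ := (b i).2
    exact ⟨g, hg, hgi⟩
  choose g hgG hg2 using hb
  -- the kernel lies in `D + mℤⁿ`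
  let D : Submodule ℤ (Fin n → ℤ) := Submodule.span ℤ (Set.range fun i => (g i).1)
  have hker : ∀ e, Φ e = 0 → ∃ x ∈ D, ∀ i, (m : ℤ) ∣ (e - x) i := by
    intro e he
    obtain ⟨c, hc⟩ := h1 e he
    have hcG2 : c ∈ G2 := ⟨(e, c), hc, rfl⟩
    let a := b.repr ⟨c, hcG2⟩
    refine ⟨∑ i, a i • (g i).1, Submodule.sum_mem _ fun i _ =>
      Submodule.smul_mem _ _ (Submodule.subset_span ⟨i, rfl⟩), ?_⟩
    apply h2
    have h3 : (e, c) - ∑ i, a i • g i ∈ G :=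
      G.sub_mem hc (G.sum_mem fun i _ => G.zsmul_mem (hgG i) _)
    have h4 : c = ∑ i, a i • (g i).2 := by
      have := congrArg Subtype.val (b.sum_repr ⟨c, hcG2⟩)
      simp only [Submodule.coe_sum, Submodule.coe_smul] at this
      rw [← this]
      exact Finset.sum_congr rfl fun i _ => by rw [hg2]
    convert h3 using 1
    ext : 1
    · simp [Prod.fst_sum]
    · simp only [Prod.snd_sub, Prod.snd_sum, Prod.smul_snd]
      rw [← h4, sub_self]
  -- quotient by `D`, modulo torsion
  let Q := (Fin n → ℤ) ⧸ D
  let F := Q ⧸ Submodule.torsion ℤ Q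
  have hrank : k ≤ Module.finrank ℤ F := by
    have e1 : Module.finrank ℤ F = Module.finrank ℤ Q := by
      have := Submodule.finrank_quotient_add_finrank (Submodule.torsion ℤ Q)
      have h0 : Module.finrank ℤ (Submodule.torsion ℤ Q) = 0 := by
        rw [Module.finrank_eq_zero_iff_isTorsion]
        exact Submodule.torsion_isTorsion
      change Module.finrank ℤ F + _ = _ at this
      omega
    have e2 := Submodule.finrank_quotient_add_finrank D
    have e3 : Module.finrank ℤ D ≤ t := by
      exact (finrank_range_le_card (R := ℤ) fun i => (g i).1).trans (by simp)
    rw [Module.finrank_fin_fun] at e2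
    change k ≤ _
    rw [e1]
    change Module.finrank ℤ Q + _ = _ at e2
    omega
  let bF := Module.finBasis ℤ F
  let q : (Fin n → ℤ) →ₗ[ℤ] F := (Submodule.mkQ _).comp (Submodule.mkQ D)
  have hq : Function.Surjective q :=
    (Submodule.mkQ_surjective _).comp (Submodule.mkQ_surjective _)
  have hqD : ∀ x ∈ D, q x = 0 := by
    intro x hx
    have : D.mkQ x = 0 := by simpa using hx
    change Submodule.mkQ _ (D.mkQ x) = 0
    rw [this, map_zero]
  let ι : Fin k → Fin (Module.finrank ℤ F) := Fin.castLE hrank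
  choose v hv using fun j : Fin k => hq (bF (ι j))
  have hcoef : ∀ c : Fin k → ℤ, Φ (∑ j, c j • v j) = 0 → ∀ j, (m : ℤ) ∣ c j := by
    intro c hc j
    obtain ⟨x, hxD, hx⟩ := hker _ hc
    choose w hw using hx
    have h5 : ∑ j, c j • v j = x + (m : ℤ) • w := by
      ext i
      have := hw i
      simp only [Pi.sub_apply] at this
      simp only [Pi.add_apply, Pi.smul_apply, smul_eq_mul]
      linarith
    have h6 := congrArg (fun y => bF.repr (q y) (ι j)) h5
    simp only [map_add, map_sum, map_smul, hqD x hxD, hv, zero_add] at h6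
    refine ⟨bF.repr (q w) (ι j), ?_⟩
    have h7 : ∑ i, (c i • bF.repr (bF (ι i))) (ι j) = c j := by
      simp only [Module.Basis.repr_self, Finsupp.smul_single, smul_eq_mul, mul_one,
        Finsupp.single_apply]
      rw [Finset.sum_eq_single j]
      · simp
      · intro b _ hbj
        rw [if_neg]
        exact fun h => hbj (Fin.castLE_injective hrank h)
      · simp
    rw [← h7]
    simpa [Finsupp.finsetSum_apply] using h6
  -- the embedding
  have hlift : ∀ j, (zmultiplesHom A (Φ (v j))) (m : ℤ) = 0 := by
    intro j
    simpa using hΦ (v j)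
  let f : (Fin k → ZMod m) →+ A :=
    ∑ j, (ZMod.lift m ⟨zmultiplesHom A (Φ (v j)), hlift j⟩).comp (Pi.evalAddMonoidHom _ j)
  refine ⟨f, (injective_iff_map_eq_zero f).2 fun y hy => ?_⟩
  choose c hc using fun j => ZMod.intCast_surjective (y j)
  have h8 : f y = Φ (∑ j, c j • v j) := by
    simp only [f, AddMonoidHom.finsetSum_apply, AddMonoidHom.comp_apply, Pi.evalAddMonoidHom_apply,
      map_sum, ← hc, ZMod.lift_coe, zmultiplesHom_apply, map_zsmul]
  ext j
  rw [← hc j, Pi.zero_apply, ZMod.intCast_zmod_eq_zero_iff_dvd]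
  exact hcoef c (h8 ▸ hy) j

open nonZeroDivisors in
theorem exists_unit_of_toPrincipalIdeal_eq_one {R K : Type*} [CommRing R] [IsDomain R] [Field K]
    [Algebra R K] [IsFractionRing R K] {x : Kˣ} (hx : toPrincipalIdeal R K x = 1) :
    ∃ u : Rˣ, algebraMap R K u = x := by
  have key : ∀ y : Kˣ, toPrincipalIdeal R K y = 1 → ∃ a : R, algebraMap R K a = y := by
    intro y hy
    have h := congrArg Units.val hy
    rw [coe_toPrincipalIdeal, Units.val_one] at h
    rw [← FractionalIdeal.mem_one_iff R⁰, ← h]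
    exact FractionalIdeal.mem_spanSingleton_self _ _
  obtain ⟨a, ha⟩ := key x hx
  obtain ⟨b, hb⟩ := key x⁻¹ (by rw [map_inv, hx, inv_one])
  have hab : a * b = 1 := by
    apply IsFractionRing.injective R K
    rw [map_mul, ha, hb, map_one, ← Units.val_mul, mul_inv_cancel, Units.val_one]
  exact ⟨Units.mkOfMulEqOne a b hab, ha⟩

/-- If the ideals generated by `x₁, …, xₙ` are `m`-th powers and `x₁, …, xₙ` are independent modulo
`m`-th powers and roots of unity, then the `m`-rank of the class group is at least
`n - rank (𝓞 K)ˣ`. -/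
theorem exists_injective_classGroup {K : Type*} [Field K] [NumberField K] {m n k : ℕ}
    (hk : k + Units.rank K ≤ n) (x : Fin n → Kˣ)
    (J : Fin n → (FractionalIdeal (nonZeroDivisors (𝓞 K)) K)ˣ)
    (hJ : ∀ i, toPrincipalIdeal (𝓞 K) K (x i) = J i ^ m)
    (hind : ∀ (e : Fin n → ℤ) (ζ y : Kˣ), IsOfFinOrder ζ → ∏ i, x i ^ e i = ζ * y ^ m →
      ∀ i, (m : ℤ) ∣ e i) :
    ∃ f : (Fin k → ZMod m) →+ Additive (ClassGroup (𝓞 K)), Function.Injective f := by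
  classical
  let P := (toPrincipalIdeal (𝓞 K) K).range
  let ε : Fin (Units.rank K) → Kˣ := fun i =>
    Units.map (algebraMap (𝓞 K) K : 𝓞 K →* K) (Units.fundSystem K i)
  let A := Additive ((FractionalIdeal (nonZeroDivisors (𝓞 K)) K)ˣ ⧸ P)
  let _ : AddCommGroup A := Additive.addCommGroup
  let Φ : (Fin n → ℤ) →+ A :=
    { toFun := fun e => Additive.ofMul (QuotientGroup.mk (∏ i, J i ^ e i))
      map_zero' := by simp
      map_add' := fun a b => by
        simp only [Pi.add_apply, zpow_add, Finset.prod_mul_distrib, QuotientGroup.mk_mul,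
          ofMul_mul] }
  let G : AddSubgroup ((Fin n → ℤ) × (Fin (Units.rank K) → ℤ)) :=
    { carrier := {g | ∃ ζ y : Kˣ, IsOfFinOrder ζ ∧
        (∏ i, x i ^ g.1 i) * ∏ i, ε i ^ g.2 i = ζ * y ^ m}
      zero_mem' := ⟨1, 1, IsOfFinOrder.one, by simp⟩
      add_mem' := by
        rintro a b ⟨ζ, y, hζ, h⟩ ⟨ζ', y', hζ', h'⟩
        refine ⟨ζ * ζ', y * y', hζ.mul hζ', ?_⟩
        simp only [Prod.fst_add, Prod.snd_add, Pi.add_apply, zpow_add, Finset.prod_mul_distrib]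
        rw [mul_pow, mul_mul_mul_comm, h, h', mul_mul_mul_comm]
      neg_mem' := by
        rintro a ⟨ζ, y, hζ, h⟩
        refine ⟨ζ⁻¹, y⁻¹, hζ.inv, ?_⟩
        simp only [Prod.fst_neg, Prod.snd_neg, Pi.neg_apply, zpow_neg, Finset.prod_inv_distrib]
        rw [inv_pow, ← mul_inv, h, mul_inv] }
  have hxJ : ∀ e : Fin n → ℤ,
      toPrincipalIdeal (𝓞 K) K (∏ i, x i ^ e i) = (∏ i, J i ^ e i) ^ m := by
    intro e
    rw [map_prod, ← Finset.prod_pow]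
    refine Finset.prod_congr rfl fun i _ => ?_
    rw [map_zpow, hJ, ← zpow_natCast, ← zpow_natCast, zpow_comm]
  have hΦ : ∀ v, m • Φ v = 0 := by
    intro v
    have h : (QuotientGroup.mk ((∏ i, J i ^ v i) ^ m) :
        (FractionalIdeal (nonZeroDivisors (𝓞 K)) K)ˣ ⧸ P) = 1 := by
      rw [QuotientGroup.eq_one_iff, ← hxJ]
      exact ⟨_, rfl⟩
    exact congrArg Additive.ofMul h
  have hlift : ∀ e, Φ e = 0 → ∃ c, (e, c) ∈ G := by
    intro e he
    have h1 : ∏ i, J i ^ e i ∈ P := (QuotientGroup.eq_one_iff _).1 (congrArg Additive.toMul he)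
    obtain ⟨y, hy⟩ := h1
    have h2 : toPrincipalIdeal (𝓞 K) K ((∏ i, x i ^ e i) * (y ^ m)⁻¹) = 1 := by
      rw [map_mul, hxJ, ← hy, map_inv, map_pow, mul_inv_cancel]
    obtain ⟨u, hu⟩ := exists_unit_of_toPrincipalIdeal_eq_one h2
    obtain ⟨⟨ζ, c⟩, hc, -⟩ := Units.exist_unique_eq_mul_prod K u
    refine ⟨-c, Units.map (algebraMap (𝓞 K) K : 𝓞 K →* K) ζ.1, y, ?_, ?_⟩
    · exact (Units.map (algebraMap (𝓞 K) K : 𝓞 K →* K)).isOfFinOrder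
        ((CommGroup.mem_torsion _).1 ζ.2)
    · have h3 : Units.map (algebraMap (𝓞 K) K : 𝓞 K →* K) u =
          (∏ i, x i ^ e i) * (y ^ m)⁻¹ := Units.ext hu
      rw [hc, map_mul, map_prod] at h3
      simp only [map_zpow] at h3
      change (∏ i, x i ^ e i) * ∏ i, ε i ^ (-c i) = _
      simp only [zpow_neg, Finset.prod_inv_distrib]
      rw [mul_inv_eq_iff_eq_mul, mul_right_comm]
      change _ = _ * (∏ i, (Units.map (algebraMap (𝓞 K) K : 𝓞 K →* K)
        (Units.fundSystem K i)) ^ c i) * _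
      rw [h3, inv_mul_cancel_right]
  have hG : ∀ e, (e, (0 : Fin (Units.rank K) → ℤ)) ∈ G → ∀ i, (m : ℤ) ∣ e i := by
    rintro e ⟨ζ, y, hζ, h⟩
    exact hind e ζ y hζ (by simpa using h)
  obtain ⟨f, hf⟩ := exists_injective_of_kernel_lift hk Φ hΦ G hlift hG
  let E := (ClassGroup.equiv (R := 𝓞 K) K).symm.toAdditive
  exact ⟨E.toAddMonoidHom.comp f, E.injective.comp hf⟩

theorem pow_factorial_two_mul_finrank_eq_one {K : Type*} [Field K] [NumberField K] {ζ : K}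
    (hζ : IsOfFinOrder ζ) : ζ ^ (2 * Module.finrank ℚ K).factorial = 1 := by
  have hpos : 0 < orderOf ζ := hζ.orderOf_pos
  have hprim := IsPrimitiveRoot.orderOf ζ
  have htot : (orderOf ζ).totient ≤ Module.finrank ℚ K := by
    have := hprim.lcm_totient_le_finrank (K := ℚ) hprim
      (by rw [Nat.lcm_self]; exact Polynomial.cyclotomic.irreducible_rat hpos)
    rwa [Nat.lcm_self] at this
  refine orderOf_dvd_iff_pow_eq_one.1 ((Nat.dvd_iff_prime_pow_dvd_dvd _ _).2 fun q a hq hqa => ?_)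
  rcases Nat.eq_zero_or_pos a with rfl | ha
  · simp
  refine Nat.dvd_factorial (pow_pos hq.pos _) ?_
  have h1 : (q ^ a).totient ≤ Module.finrank ℚ K :=
    (Nat.le_of_dvd (Nat.totient_pos.2 hpos) (Nat.totient_dvd_of_dvd hqa)).trans htot
  rw [Nat.totient_prime_pow hq ha] at h1
  have h2 : q ≤ 2 * (q - 1) := by have := hq.two_le; omega
  calc q ^ a = q ^ (a - 1) * q := by rw [← pow_succ, Nat.sub_add_cancel ha]
    _ ≤ q ^ (a - 1) * (2 * (q - 1)) := Nat.mul_le_mul_left _ h2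
    _ = 2 * (q ^ (a - 1) * (q - 1)) := by ring
    _ ≤ _ := Nat.mul_le_mul_left _ h1

/-- If one of the `x i` reduces to a primitive root modulo `p` and the others reduce to `1`, then a
relation between the `x i` modulo `m`-th powers and roots of unity of order dividing `B` has an
exponent divisible by `m` at that place, provided `m * B ∣ p - 1`. -/
theorem dvd_exponent_of_residues {K ι : Type*} [Field K] [Fintype ι] [DecidableEq ι]
    {p m B : ℕ} [Fact p.Prime] (hm : 0 < m) (hp : m * B ∣ p - 1) (σ : K →+* ℚ_[p]) (x : ι → Kˣ)
    (a : ι → ℤ_[p]) (ha : ∀ i, σ (x i) = a i) (j : ι)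
    (g : (ZMod p)ˣ) (hg : orderOf g = p - 1)
    (hres : ∀ i, PadicInt.toZMod (a i) = ((if i = j then g else 1 : (ZMod p)ˣ) : ZMod p))
    (e : ι → ℤ) (ζ y : Kˣ) (hζ : ζ ^ B = 1) (h : ∏ i, x i ^ e i = ζ * y ^ m) :
    (m : ℤ) ∣ e j := by
  have hp1 : 0 < p - 1 := Nat.sub_pos_of_lt (Fact.out : p.Prime).one_lt
  have hB : B ≠ 0 := by
    rintro rfl
    rw [mul_zero, zero_dvd_iff] at hp
    omega
  have ha1 : ∀ i, ‖(a i : ℚ_[p])‖ = 1 := by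
    intro i
    by_contra hne
    have hlt : ‖a i‖ < 1 := lt_of_le_of_ne (PadicInt.norm_le_one _) hne
    rw [PadicInt.norm_lt_one_iff_dvd, ← Ideal.mem_span_singleton, ← PadicInt.maximalIdeal_eq_span_p,
      ← PadicInt.ker_toZMod, RingHom.mem_ker, hres] at hlt
    exact Units.ne_zero _ hlt
  have hz1 : ‖σ ζ‖ = 1 := by
    have h1 : σ ζ ^ B = 1 := by rw [← map_pow, ← Units.val_pow_eq_pow_val, hζ]; simp
    have h2 : ‖σ ζ‖ ^ B = 1 := by rw [← norm_pow, h1, norm_one]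
    exact (pow_eq_one_iff_of_nonneg (norm_nonneg _) hB).1 h2
  have hσ : ∏ i, (a i : ℚ_[p]) ^ e i = σ ζ * σ y ^ m := by
    have := congrArg (fun u : Kˣ => σ u) h
    simpa [ha] using this
  have hy1 : ‖σ y‖ = 1 := by
    have h1 := congrArg norm hσ
    rw [norm_prod, norm_mul, norm_pow, hz1, one_mul] at h1
    simp only [norm_zpow, ha1, one_zpow, Finset.prod_const_one] at h1
    exact (pow_eq_one_iff_of_nonneg (norm_nonneg _) hm.ne').1 h1.symm
  let A : ι → ℤ_[p]ˣ := fun i => PadicInt.mkUnits (ha1 i)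
  let z : ℤ_[p]ˣ := PadicInt.mkUnits hz1
  let w : ℤ_[p]ˣ := PadicInt.mkUnits hy1
  let τ : ℤ_[p]ˣ →* ℚ_[p]ˣ := Units.map (PadicInt.Coe.ringHom : ℤ_[p] →+* ℚ_[p])
  have hτ : Function.Injective τ := Units.map_injective Subtype.coe_injective
  have hA : ∏ i, A i ^ e i = z * w ^ m := by
    apply hτ
    apply Units.ext
    rw [map_prod, map_mul, map_pow]
    simp only [map_zpow]
    push_cast
    exact hσ
  have hzB : z ^ B = 1 := by
    apply hτ
    apply Units.ext
    rw [map_pow, map_one]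
    push_cast
    change σ ζ ^ B = 1
    rw [← map_pow, ← Units.val_pow_eq_pow_val, hζ]
    simp
  let ρ : ℤ_[p]ˣ →* (ZMod p)ˣ := Units.map (PadicInt.toZMod : ℤ_[p] →+* ZMod p)
  have hρA : ∀ i, ρ (A i) = if i = j then g else 1 := by
    intro i
    apply Units.ext
    rw [← hres]
    rfl
  have h3 : g ^ e j = ρ z * ρ w ^ m := by
    rw [← map_pow, ← map_mul, ← hA, map_prod, Finset.prod_eq_single j]
    · rw [map_zpow, hρA, if_pos rfl]
    · intro i _ hij
      rw [map_zpow, hρA, if_neg hij, one_zpow]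
    · simp
  obtain ⟨t, ht⟩ := hp
  have h4 : g ^ (e j * (B * t : ℕ)) = 1 := by
    rw [zpow_mul, h3, zpow_natCast, mul_pow, ← map_pow, pow_mul, hzB, one_pow, map_one, one_mul,
      ← pow_mul, ← mul_assoc, ← ht, ZMod.units_pow_card_sub_one_eq_one]
  rw [← orderOf_dvd_iff_zpow_eq_one, hg, ht, mul_assoc, Nat.cast_mul] at h4
  refine Int.dvd_of_mul_dvd_mul_right ?_ h4
  have : B * t ≠ 0 := by
    intro h0
    rw [mul_assoc, h0, mul_zero] at ht
    omega
  exact_mod_cast this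

open Polynomial in
/-- A simple root of `f` modulo `p` at `0` gives an embedding of `ℚ[X]/(f)` into `ℚ_p` sending the
generator into `p ℤ_p`. -/
theorem exists_padic_embedding {K : Type*} [Field K] [Algebra ℚ K] (pb : PowerBasis ℚ K)
    (f : ℤ[X]) (hf : minpoly ℚ pb.gen = f.map (Int.castRingHom ℚ)) {p : ℕ} [Fact p.Prime]
    (h0 : ((f.eval 0 : ℤ) : ZMod p) = 0) (h1 : ((f.derivative.eval 0 : ℤ) : ZMod p) ≠ 0) :
    ∃ (σ : K →+* ℚ_[p]) (t : ℤ_[p]), σ pb.gen = t ∧ PadicInt.toZMod t = 0 := by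
  have e0 : ∀ P : ℤ[X], aeval (0 : ℤ_[p]) P = (P.eval 0 : ℤ) := by
    intro P
    have := aeval_algebraMap_apply ℤ_[p] (0 : ℤ) P
    simpa using this
  have hd : ‖aeval (0 : ℤ_[p]) (derivative f)‖ = 1 := by
    rw [e0]
    refine le_antisymm (PadicInt.norm_le_one _) (not_lt.1 fun h => h1 ?_)
    rw [PadicInt.norm_int_lt_one_iff_dvd] at h
    exact (ZMod.intCast_zmod_eq_zero_iff_dvd _ _).2 h
  have hn : ‖aeval (0 : ℤ_[p]) f‖ < 1 := by
    rw [e0, PadicInt.norm_int_lt_one_iff_dvd]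
    exact (ZMod.intCast_zmod_eq_zero_iff_dvd _ _).1 h0
  obtain ⟨t, ht, ht', -⟩ := hensels_lemma (F := f) (a := (0 : ℤ_[p])) (by rw [hd]; simpa using hn)
  rw [hd, sub_zero] at ht'
  refine ⟨(pb.lift (t : ℚ_[p]) ?_ : K →ₐ[ℚ] ℚ_[p]).toRingHom, t, pb.lift_gen _ _, ?_⟩
  · rw [hf]
    change aeval (t : ℚ_[p]) (f.map (algebraMap ℤ ℚ)) = 0
    rw [aeval_map_algebraMap]
    have h2 := aeval_algebraMap_apply ℚ_[p] t f
    rw [ht, map_zero] at h2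
    exact h2
  · rw [← RingHom.mem_ker, PadicInt.ker_toZMod, PadicInt.maximalIdeal_eq_span_p,
      Ideal.mem_span_singleton]
    exact (PadicInt.norm_lt_one_iff_dvd t).1 ht'

open nonZeroDivisors in
/-- Pairwise coprime elements of a Dedekind domain whose product is an `m`-th power up to sign
generate `m`-th powers of ideals. -/
theorem exists_fractionalIdeal_pow_eq {R K ι : Type*} [CommRing R] [IsDedekindDomain R] [Field K]
    [Algebra R K] [IsFractionRing R K] [Fintype ι] {m : ℕ} (hm : m ≠ 0) (x : ι → R) (c : R)
    (hcop : ∀ i j, i ≠ j → IsCoprime (x i) (x j)) (hprod : ∏ i, x i = -c ^ m)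
    (i : ι) (u : Kˣ) (hu : (u : K) = algebraMap R K (x i)) :
    ∃ J : (FractionalIdeal R⁰ K)ˣ, toPrincipalIdeal R K u = J ^ m := by
  classical
  let _ : GCDMonoid (Ideal R) := UniqueFactorizationMonoid.toGCDMonoid _
  have hI : ∏ i, Ideal.span {x i} = Ideal.span {c} ^ m := by
    rw [Ideal.prod_span_singleton, hprod, Ideal.span_singleton_neg, Ideal.span_singleton_pow]
  obtain ⟨I, hI⟩ := Finset.exists_eq_pow_of_mul_eq_pow_of_coprime (s := Finset.univ)
    (fun i _ j _ hij => Ideal.isCoprime_span_singleton_iff _ _ |>.2 (hcop i j hij)) hI i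
    (Finset.mem_univ i)
  have hx : x i ≠ 0 := by
    intro h
    rw [h, map_zero] at hu
    exact u.ne_zero hu
  have hI0 : I ≠ ⊥ := by
    rintro rfl
    rw [Ideal.bot_pow hm, Ideal.span_singleton_eq_bot] at hI
    exact hx hI
  have hI0' : (I : FractionalIdeal R⁰ K) ≠ 0 := FractionalIdeal.coeIdeal_ne_zero.2 hI0
  refine ⟨Units.mk0 _ hI0', ?_⟩
  rw [toPrincipalIdeal_eq_iff, hu, ← FractionalIdeal.coeIdeal_span_singleton, hI,
    FractionalIdeal.coeIdeal_pow, Units.val_pow_eq_pow_val, Units.val_mk0]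

/-- A number field containing a root of an Eisenstein polynomial at `ℓ` is ramified at `ℓ`. -/
theorem dvd_discr_of_eisenstein {K : Type*} [Field K] [NumberField K] {ℓ : ℕ} (hℓ : ℓ.Prime)
    (θ : 𝓞 K) (d : ℕ) (hd : 2 ≤ d) (w : 𝓞 K) (c : ℤ) (hc : ¬ (ℓ : ℤ) ∣ c)
    (h : θ ^ d = ℓ * (c + θ * w)) : (ℓ : ℤ) ∣ discr K := by
  by_contra hdisc
  have hℓ' : Prime (ℓ : ℤ) := Nat.prime_iff_prime_int.1 hℓ
  rw [not_dvd_discr_iff_forall_liesOver K (𝓞 K) hℓ'] at hdisc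
  have : Fact ℓ.Prime := ⟨hℓ⟩
  have : (Ideal.span {(ℓ : ℤ)}).IsMaximal := Int.ideal_span_isMaximal_of_prime ℓ
  obtain ⟨P, hP, hPℓ⟩ := Ideal.exists_maximal_ideal_liesOver_of_isIntegral (S := 𝓞 K)
    (Ideal.span {(ℓ : ℤ)})
  have hun := hdisc P hP hPℓ
  have hℓP : (ℓ : 𝓞 K) ∈ P := by
    have := (Ideal.mem_of_liesOver P (Ideal.span {(ℓ : ℤ)}) (ℓ : ℤ)).1
      (Ideal.mem_span_singleton_self _)
    simpa using this
  have hθP : θ ∈ P := hP.isPrime.mem_of_pow_mem d (h ▸ P.mul_mem_right _ hℓP)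
  have hcP : (c : 𝓞 K) + θ * w ∉ P := by
    intro hmem
    have hc' : (c : 𝓞 K) ∈ P := by
      simpa using P.sub_mem hmem (P.mul_mem_right w hθP)
    obtain ⟨a, b, hab⟩ := (Prime.coprime_iff_not_dvd hℓ').2 hc
    refine hP.ne_top ((Ideal.eq_top_iff_one P).2 ?_)
    have h1 := congrArg (Int.cast : ℤ → 𝓞 K) hab
    push_cast at h1
    rw [← h1]
    exact P.add_mem (P.mul_mem_left _ hℓP) (P.mul_mem_left _ hc')
  have hℓP2 : (ℓ : 𝓞 K) ∈ P ^ 2 := by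
    have := Ideal.pow_le_pow_right hd (h ▸ Ideal.pow_mem_pow hθP d)
    exact (Ideal.IsPrime.mul_mem_pow P (mul_comm (ℓ : 𝓞 K) _ ▸ this)).resolve_left hcP
  have hP0 : P ≠ ⊥ := by
    rintro rfl
    rw [Ideal.mem_bot, Nat.cast_eq_zero] at hℓP
    exact hℓ.ne_zero hℓP
  have hle (J : Ideal (𝓞 K)) (hJ : (ℓ : 𝓞 K) ∈ J) :
      (Ideal.span {(ℓ : ℤ)}).map (algebraMap ℤ (𝓞 K)) ≤ J := by
    rw [Ideal.map_span, Set.image_singleton, Ideal.span_singleton_le_iff_mem]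
    simpa using hJ
  refine (Ideal.ramificationIdx'_ne_one_iff (hle P hℓP)).2 (hle _ hℓP2) ?_
  rw [Ideal.IsDedekindDomain.ramificationIdx'_eq_one_iff hP0 (hle P hℓP)]
  let _ := Localization.AtPrime.algebraOfLiesOver (Ideal.span {(ℓ : ℤ)}) P
  exact ((Algebra.isUnramifiedAt_iff_map_eq ℤ (Ideal.span {(ℓ : ℤ)}) P).1 hun).2

open Polynomial in
/-- The number of real places of `ℚ(θ)` is the number of real roots of the minimal polynomial of
`θ`. -/
theorem nrRealPlaces_eq_ncard {K : Type*} [Field K] [NumberField K] (pb : PowerBasis ℚ K) :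
    InfinitePlace.nrRealPlaces K = {x : ℝ | aeval x (minpoly ℚ pb.gen) = 0}.ncard := by
  classical
  rw [← InfinitePlace.card_real_embeddings, ← Nat.card_eq_fintype_card, ← Nat.card_coe_set_eq]
  have hψ (ψ : K →ₐ[ℚ] ℝ) :
      ComplexEmbedding.IsReal (Complex.ofRealHom.comp (ψ : K →+* ℝ)) := by
    ext x; simp [ComplexEmbedding.conjugate_coe_eq]
  let e : {φ : K →+* ℂ // ComplexEmbedding.IsReal φ} ≃ (K →ₐ[ℚ] ℝ) :=
    { toFun φ := φ.2.embedding.toRatAlgHom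
      invFun ψ := ⟨_, hψ ψ⟩
      left_inv φ := by
        ext x
        exact φ.2.coe_embedding_apply x
      right_inv ψ := by
        ext x
        apply Complex.ofReal_injective
        exact (hψ ψ).coe_embedding_apply x }
  exact Nat.card_congr (e.trans pb.liftEquiv)

theorem nrComplexPlaces_eq_and_rank_le {K : Type*} [Field K] [NumberField K] {d r₁ r₂ : ℕ}
    (hd : 0 < d) (hsig : r₁ + 2 * r₂ = d) (hK : Module.finrank ℚ K = d)
    (h : InfinitePlace.nrRealPlaces K = r₁) :
    InfinitePlace.nrComplexPlaces K = r₂ ∧ r₂ + Units.rank K ≤ d - 1 := by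
  have h1 := InfinitePlace.card_add_two_mul_card_eq_rank K
  have h2 := InfinitePlace.card_eq_nrRealPlaces_add_nrComplexPlaces K
  rw [Units.rank, h2]
  omega

open Polynomial in
/-- A complex polynomial has a root near every point where its logarithmic derivative is large. -/
theorem exists_root_norm_sub_mul_le {p : ℂ[X]} {d : ℕ} (hd : p.natDegree ≤ d) {z : ℂ}
    (hz : p.derivative.eval z ≠ 0) :
    ∃ ρ, p.IsRoot ρ ∧ ‖z - ρ‖ * ‖p.derivative.eval z‖ ≤ d * ‖p.eval z‖ := by
  by_cases h0 : p.eval z = 0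
  · exact ⟨z, h0, by simp [h0]⟩
  have hp : p ≠ 0 := by
    rintro rfl
    simp at h0
  have hsum := (IsAlgClosed.splits p).eval_derivative_div_eval_of_ne_zero h0
  have hne : p.roots.toFinset.Nonempty := by
    rw [Finset.nonempty_iff_ne_empty, Ne, Multiset.toFinset_eq_empty]
    intro h
    rw [h, Multiset.map_zero, Multiset.sum_zero, div_eq_zero_iff] at hsum
    exact hsum.elim hz h0
  obtain ⟨ρ, hρ, hmin⟩ := Finset.exists_min_image _ (fun ρ => ‖z - ρ‖) hne
  rw [Multiset.mem_toFinset, mem_roots hp] at hρ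
  have hρz : 0 < ‖z - ρ‖ := by
    rw [norm_pos_iff, sub_ne_zero]
    rintro rfl
    exact h0 hρ
  refine ⟨ρ, hρ, ?_⟩
  have hle : ‖p.derivative.eval z / p.eval z‖ ≤ d * (1 / ‖z - ρ‖) := by
    rw [hsum]
    refine (norm_multiset_sum_le _).trans ?_
    refine (Multiset.sum_le_card_nsmul _ (1 / ‖z - ρ‖) ?_).trans ?_
    · intro x hx
      simp only [Multiset.map_map, Multiset.mem_map, Function.comp_apply] at hx
      obtain ⟨a, ha, rfl⟩ := hx
      rw [norm_div, norm_one]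
      exact one_div_le_one_div_of_le hρz (hmin a (Multiset.mem_toFinset.2 ha))
    · rw [nsmul_eq_mul, Multiset.card_map, Multiset.card_map]
      gcongr
      exact (card_roots' p).trans hd
  rw [norm_div, mul_one_div, div_le_div_iff₀ (norm_pos_iff.2 h0) hρz] at hle
  linarith

open Polynomial in
/-- The polynomial `∏ᵢ (αᵢ X + βᵢ) + 1`. -/
noncomputable def prodLinearAddOne {R ι : Type*} [CommSemiring R] [Fintype ι] (α β : ι → R) :
    R[X] :=
  ∏ i, (C (α i) * X + C (β i)) + 1

open Polynomial in
theorem natDegree_prodLinearAddOne_le {R ι : Type*} [CommSemiring R] [Fintype ι] (α β : ι → R) :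
    (prodLinearAddOne α β).natDegree ≤ Fintype.card ι := by
  refine natDegree_add_le_of_degree_le ((natDegree_prod_le _ _).trans ?_) (by simp)
  refine (Finset.sum_le_card_nsmul _ _ 1 fun i _ => natDegree_linear_le).trans ?_
  simp

open Polynomial in
theorem eval_prodLinearAddOne {R ι : Type*} [CommSemiring R] [Fintype ι] (α β : ι → R) (z : R) :
    (prodLinearAddOne α β).eval z = ∏ i, (α i * z + β i) + 1 := by
  simp [prodLinearAddOne, eval_prod]

open Polynomial Filter Topology in
/-- A simple root of a limit polynomial is a limit of roots, even if the degree drops. -/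
theorem eventually_exists_root_prodLinearAddOne {ι T : Type*} [Fintype ι] {l : Filter T}
    {α β : T → ι → ℂ} {α₀ β₀ : ι → ℂ} (hα : Tendsto α l (𝓝 α₀)) (hβ : Tendsto β l (𝓝 β₀)) {z : ℂ}
    (h0 : (prodLinearAddOne α₀ β₀).eval z = 0)
    (h1 : (prodLinearAddOne α₀ β₀).derivative.eval z ≠ 0) {ε : ℝ} (hε : 0 < ε) :
    ∀ᶠ t in l, ∃ ρ, (prodLinearAddOne (α t) (β t)).IsRoot ρ ∧ ‖z - ρ‖ < ε := by
  classical
  have hc0 : Continuous fun q : (ι → ℂ) × (ι → ℂ) => (prodLinearAddOne q.1 q.2).eval z := by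
    simp only [eval_prodLinearAddOne]
    fun_prop
  have hc1 : Continuous fun q : (ι → ℂ) × (ι → ℂ) =>
      (prodLinearAddOne q.1 q.2).derivative.eval z := by
    simp only [prodLinearAddOne, derivative_add, derivative_one, add_zero, derivative_prod_finset,
      eval_finsetSum, eval_mul, eval_prod, eval_add, eval_C, eval_X, derivative_mul, derivative_C,
      derivative_X]
    fun_prop
  have hαβ := hα.prodMk_nhds hβ
  have ht0 := ((hc0.tendsto (α₀, β₀)).comp hαβ).norm.const_mul (Fintype.card ι : ℝ)
  have ht1 := ((hc1.tendsto (α₀, β₀)).comp hαβ).norm.const_mul ε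
  simp only [h0, norm_zero, mul_zero] at ht0
  have hpos : 0 < ‖(prodLinearAddOne α₀ β₀).derivative.eval z‖ := norm_pos_iff.2 h1
  filter_upwards [ht0.eventually_lt ht1 (by positivity),
    ((hc1.tendsto (α₀, β₀)).comp hαβ).eventually_ne h1] with t hlt hne
  obtain ⟨ρ, hρ, hle⟩ := exists_root_norm_sub_mul_le (natDegree_prodLinearAddOne_le _ _) hne
  exact ⟨ρ, hρ, lt_of_mul_lt_mul_right (hle.trans_lt hlt) (norm_nonneg _)⟩

open Polynomial Filter Topology in
theorem eventually_exists_nonreal_roots {ι T : Type*} [Fintype ι] {l : Filter T}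
    {α β : T → ι → ℂ} {α₀ β₀ : ι → ℂ} (hα : Tendsto α l (𝓝 α₀)) (hβ : Tendsto β l (𝓝 β₀)) {r : ℕ}
    (hr : prodLinearAddOne α₀ β₀ = X ^ (2 * r) + 1) :
    ∀ᶠ t in l, ∃ g : Fin (2 * r) → ℂ, Function.Injective g ∧
      ∀ k, (prodLinearAddOne (α t) (β t)).IsRoot (g k) ∧ (g k).im ≠ 0 := by
  rcases Nat.eq_zero_or_pos r with rfl | hr0
  · exact .of_forall fun _ => ⟨fun _ => 0, fun a => a.elim0, fun a => a.elim0⟩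
  set p : ℂ[X] := X ^ (2 * r) - C (-1) with hp
  have hsep : p.Separable := separable_X_pow_sub_C _ (by simp; omega) (by simp)
  have hp0 : p ≠ 0 := hsep.ne_zero
  set Z := p.roots.toFinset
  have hZ (z : ℂ) : z ∈ Z ↔ z ^ (2 * r) = -1 := by
    rw [Multiset.mem_toFinset, mem_roots hp0, IsRoot.def, hp]
    simp [add_eq_zero_iff_eq_neg]
  have hcard : Z.card = 2 * r := by
    rw [Multiset.toFinset_card_of_nodup (nodup_roots hsep),
      (splits_iff_card_roots.1 (IsAlgClosed.splits p)), hp, natDegree_X_pow_sub_C]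
  have him (z : ℂ) (hz : z ∈ Z) : z.im ≠ 0 := by
    intro h
    rw [hZ, ← Complex.re_add_im z, h] at hz
    have h2 : z.re ^ (2 * r) = -1 := by
      simp only [Complex.ofReal_zero, zero_mul, add_zero] at hz
      exact_mod_cast hz
    have := (even_two_mul r).pow_nonneg z.re
    linarith
  obtain ⟨ε, hε, hε1, hε2⟩ : ∃ ε : ℝ, 0 < ε ∧ (∀ z ∈ Z, ε < |z.im|) ∧
      ∀ z ∈ Z, ∀ w ∈ Z, z ≠ w → 2 * ε < ‖z - w‖ := by
    have hlt (a c : ℝ) (ha : 0 < a) : ∀ᶠ ε in 𝓝[>] (0 : ℝ), c * ε < a := by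
      have : Tendsto (fun ε : ℝ => c * ε) (𝓝[>] 0) (𝓝 0) :=
        tendsto_nhdsWithin_of_tendsto_nhds (by simpa using (continuous_const_mul c).tendsto 0)
      exact this.eventually_lt_const ha
    have h1 : ∀ᶠ ε in 𝓝[>] (0 : ℝ), ∀ z ∈ Z, ε < |z.im| :=
      (eventually_all_finset Z).2 fun z hz => by simpa using hlt _ 1 (abs_pos.2 (him z hz))
    have h2 : ∀ᶠ ε in 𝓝[>] (0 : ℝ), ∀ z ∈ Z, ∀ w ∈ Z, z ≠ w → 2 * ε < ‖z - w‖ :=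
      (eventually_all_finset Z).2 fun z _ => (eventually_all_finset Z).2 fun w _ =>
        eventually_imp_distrib_left.2 fun hzw => hlt _ 2 (norm_pos_iff.2 (sub_ne_zero.2 hzw))
    obtain ⟨ε, h0, h3, h4⟩ := (eventually_mem_nhdsWithin.and (h1.and h2)).exists
    exact ⟨ε, h0, h3, h4⟩
  have hev : ∀ᶠ t in l, ∀ z ∈ Z, ∃ ρ, (prodLinearAddOne (α t) (β t)).IsRoot ρ ∧ ‖z - ρ‖ < ε := by
    refine (eventually_all_finset Z).2 fun z hz => ?_
    rw [hZ] at hz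
    refine eventually_exists_root_prodLinearAddOne hα hβ ?_ ?_ hε
    · simp [hr, hz]
    · have hz0 : z ≠ 0 := by
        rintro rfl
        rw [zero_pow (by omega)] at hz
        norm_num at hz
      rw [hr]
      simp [hz0, hr0.ne', derivative_X_pow]
  filter_upwards [hev] with t ht
  choose! ρ hρ hρε using ht
  let e := Z.equivFinOfCardEq hcard
  refine ⟨fun k => ρ (e.symm k), fun a b hab => ?_, fun k => ⟨hρ _ (e.symm k).2, fun h => ?_⟩⟩
  · by_contra hne
    have h1 := hρε _ (e.symm a).2
    have h2 := hρε _ (e.symm b).2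
    have h3 := hε2 _ (e.symm a).2 _ (e.symm b).2 (fun h => hne (e.symm.injective (Subtype.ext h)))
    simp only at hab
    rw [hab] at h1
    have h4 := norm_sub_le_norm_sub_add_norm_sub (e.symm a : ℂ) (ρ (e.symm b)) (e.symm b)
    rw [norm_sub_rev (ρ (e.symm b))] at h4
    linarith
  · have h1 := hρε _ (e.symm k).2
    have h2 := Complex.abs_im_le_norm ((e.symm k : ℂ) - ρ (e.symm k))
    rw [Complex.sub_im, h, sub_zero] at h2
    linarith [hε1 _ (e.symm k).2]

open Polynomial in
theorem ncard_real_roots_eq {p : ℝ[X]} (hp : p ≠ 0) {r₁ r₂ : ℕ} (hd : p.natDegree ≤ r₁ + 2 * r₂)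
    {a : Fin r₁ → ℝ} (ha : Function.Injective a) (har : ∀ k, p.IsRoot (a k))
    {g : Fin (2 * r₂) → ℂ} (hg : Function.Injective g)
    (hgr : ∀ k, (p.map Complex.ofRealHom).IsRoot (g k) ∧ (g k).im ≠ 0) :
    {x : ℝ | p.eval x = 0}.ncard = r₁ := by
  have hS : {x : ℝ | p.eval x = 0} = p.roots.toFinset := by
    ext x
    simp [hp]
  rw [hS, Set.ncard_coe_finset]
  have hp' : p.map Complex.ofRealHom ≠ 0 :=
    (Polynomial.map_ne_zero_iff Complex.ofRealHom.injective).2 hp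
  have h1 : r₁ ≤ p.roots.toFinset.card := by
    rw [← Fintype.card_fin r₁, ← Finset.card_univ, ← Finset.card_image_of_injective _ ha]
    refine Finset.card_le_card (Finset.image_subset_iff.2 fun k _ => ?_)
    simpa [hp] using har k
  have h2 : p.roots.toFinset.card + 2 * r₂ ≤ r₁ + 2 * r₂ := by
    have hdisj : Disjoint (p.roots.toFinset.image Complex.ofReal) (Finset.univ.image g) := by
      rw [Finset.disjoint_left]
      intro z hz hz'
      obtain ⟨x, -, rfl⟩ := Finset.mem_image.1 hz
      obtain ⟨k, -, hk⟩ := Finset.mem_image.1 hz'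
      exact (hgr k).2 (hk ▸ Complex.ofReal_im x)
    have hcard := Finset.card_union_of_disjoint hdisj
    rw [Finset.card_image_of_injective _ Complex.ofReal_injective,
      Finset.card_image_of_injective _ hg, Finset.card_univ, Fintype.card_fin] at hcard
    rw [← hcard]
    refine (Finset.card_le_card (t := (p.map Complex.ofRealHom).roots.toFinset) ?_).trans
      ((Multiset.toFinset_card_le _).trans ((card_roots' _).trans (by rwa [natDegree_map])))
    refine Finset.union_subset (Finset.image_subset_iff.2 fun x hx => ?_)
      (Finset.image_subset_iff.2 fun k _ => ?_)
    · rw [Multiset.mem_toFinset, mem_roots hp] at hx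
      rw [Multiset.mem_toFinset, mem_roots hp']
      exact hx.map
    · rw [Multiset.mem_toFinset, mem_roots hp']
      exact (hgr k).1
  omega

/-- A continuous function with alternating signs at `n + 1` points has at least `n` zeros. -/
theorem exists_injective_zeros {n : ℕ} {F : ℝ → ℝ} (hF : Continuous F) {u : ℕ → ℝ}
    (hu : ∀ k < n, u (k + 1) < u k) (hs : ∀ k ≤ n, 0 < (-1) ^ k * F (u k)) :
    ∃ a : Fin n → ℝ, Function.Injective a ∧ ∀ k, F (a k) = 0 := by
  have h (k : Fin n) : ∃ x ∈ Set.Ioo (u (k + 1)) (u k), F x = 0 := by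
    have h1 := hs k k.2.le
    have h2 := hs (k + 1) k.2
    rw [pow_succ] at h2
    rcases neg_one_pow_eq_or ℝ (k : ℕ) with hk | hk
    · rw [hk] at h1 h2
      exact intermediate_value_Ioo (hu k k.2).le hF.continuousOn ⟨by linarith, by linarith⟩
    · rw [hk] at h1 h2
      exact intermediate_value_Ioo' (hu k k.2).le hF.continuousOn ⟨by linarith, by linarith⟩
  choose a ha ha' using h
  refine ⟨a, StrictAnti.injective fun i j hij => ?_, ha'⟩
  have hle (k j : ℕ) (hkj : k ≤ j) (hj : j ≤ n) : u j ≤ u k := by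
    induction j, hkj using Nat.le_induction with
    | base => exact le_rfl
    | succ j _ ih => exact (hu j hj).le.trans (ih (by omega))
  exact (ha j).2.trans_le ((hle (i + 1) j hij j.2.le).trans (ha i).1.le)

theorem card_filter_lt_or_le {d k r : ℕ} (hk : k ≤ r) (hr : r ≤ d) :
    (Finset.univ.filter fun i : Fin d => (i : ℕ) < k ∨ r ≤ (i : ℕ)).card = k + (d - r) := by
  have h : (Finset.univ.filter fun i : Fin d => (i : ℕ) < k ∨ r ≤ (i : ℕ)).map Fin.valEmbedding =
      Finset.range k ∪ Finset.Ico r d := by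
    ext x
    simp only [Finset.mem_map, Finset.mem_filter, Finset.mem_univ, true_and,
      Fin.valEmbedding_apply, Finset.mem_union, Finset.mem_range, Finset.mem_Ico]
    constructor
    · rintro ⟨i, hi, rfl⟩
      have := i.2
      omega
    · intro hx
      exact ⟨⟨x, by omega⟩, by simp; omega, rfl⟩
  rw [← Finset.card_map Fin.valEmbedding, h, Finset.card_union_of_disjoint, Finset.card_range,
    Nat.card_Ico]
  rw [Finset.disjoint_left]
  intro x hx
  simp only [Finset.mem_range, Finset.mem_Ico] at hx ⊢
  omega

theorem neg_one_pow_mul_prod_add_one_pos {ι : Type*} [Fintype ι] {y : ι → ℝ} (N : Finset ι) {k : ℕ}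
    (hk : 0 < k → N.Nonempty) (hN : (-1 : ℝ) ^ N.card = (-1) ^ k)
    (hy : ∀ i ∈ N, y i ≤ -2 ^ Fintype.card ι) (hy' : ∀ i ∉ N, 1 / 2 ≤ y i) :
    0 < (-1) ^ k * (∏ i, y i + 1) := by
  classical
  set w : ι → ℝ := fun i => if i ∈ N then -y i else y i with hw
  have h2 : (1 : ℝ) ≤ 2 ^ Fintype.card ι := one_le_pow₀ (by norm_num)
  have hw2 (i : ι) : 1 / 2 ≤ w i := by
    by_cases hi : i ∈ N
    · simp only [hw, hi, if_true]
      linarith [hy i hi]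
    · simpa only [hw, hi, if_false] using hy' i hi
  have hprod : ∏ i, y i = (-1) ^ k * ∏ i, w i := by
    have h (i : ι) : y i = (if i ∈ N then -1 else 1) * w i := by
      by_cases hi : i ∈ N <;> simp [hw, hi]
    rw [Finset.prod_congr rfl fun i _ => h i, Finset.prod_mul_distrib, Finset.prod_ite_mem,
      Finset.univ_inter, Finset.prod_const, hN]
  have hsq : ((-1 : ℝ) ^ k) * (-1) ^ k = 1 := by
    rw [← mul_pow]; simp
  have hpos : 0 < ∏ i, w i := Finset.prod_pos fun i _ => by linarith [hw2 i]
  rw [hprod, mul_add, ← mul_assoc, hsq, one_mul, mul_one]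
  rcases Nat.eq_zero_or_pos k with rfl | hk0
  · rw [pow_zero]
    linarith
  obtain ⟨i₀, hi₀⟩ := hk hk0
  have hgt : 1 < ∏ i, w i := by
    rw [← Finset.mul_prod_erase _ _ (Finset.mem_univ i₀)]
    have h3 : (1 / 2 : ℝ) ^ (Fintype.card ι - 1) ≤ ∏ i ∈ Finset.univ.erase i₀, w i := by
      rw [← Finset.card_univ, ← Finset.card_erase_of_mem (Finset.mem_univ i₀), ← Finset.prod_const]
      exact Finset.prod_le_prod (fun _ _ => by norm_num) fun i _ => hw2 i
    have h4 : (2 : ℝ) ^ Fintype.card ι ≤ w i₀ := by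
      simp only [hw, hi₀, if_true]
      linarith [hy i₀ hi₀]
    have hc : Fintype.card ι = (Fintype.card ι - 1) + 1 := by
      have := Fintype.card_pos_iff.2 ⟨i₀⟩
      omega
    calc (1 : ℝ) < 2 := by norm_num
      _ = 2 ^ Fintype.card ι * (1 / 2) ^ (Fintype.card ι - 1) := by
        rw [hc, Nat.add_sub_cancel, pow_succ, mul_right_comm, ← mul_pow]
        norm_num
      _ ≤ _ := mul_le_mul h4 h3 (by positivity) (by linarith)
  rcases neg_one_pow_eq_or ℝ k with h | h <;> rw [h] <;> linarith

/-- The slopes of the factors of the rescaled polynomial. -/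
noncomputable def slopeSeq (r d P : ℕ) (i : Fin d) : ℝ :=
  if (i : ℕ) < r then (P : ℝ)⁻¹ ^ (2 * (i : ℕ) + 2) else 1

/-- The constant terms of the factors of the rescaled polynomial. -/
noncomputable def constSeq (r d : ℕ) (b : Fin d → ℤ) (P : ℕ) (i : Fin d) : ℝ :=
  if (i : ℕ) < r then 1 - b i * (P : ℝ)⁻¹ ^ (2 * (i : ℕ) + 4) else -(b i * (P : ℝ)⁻¹ ^ 2)

open Filter Topology in
theorem tendsto_inv_natCast_pow {n : ℕ} (hn : n ≠ 0) :
    Tendsto (fun P : ℕ => (P : ℝ)⁻¹ ^ n) atTop (𝓝 0) := by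
  simpa [hn] using (tendsto_inv_atTop_zero.comp (tendsto_natCast_atTop_atTop (R := ℝ))).pow n

open Filter Topology in
theorem tendsto_slopeSeq (r d : ℕ) :
    Tendsto (slopeSeq r d) atTop (𝓝 fun i => if (i : ℕ) < r then 0 else 1) := by
  refine tendsto_pi_nhds.2 fun i => ?_
  by_cases hi : (i : ℕ) < r
  · simp only [slopeSeq, hi, if_true]
    exact tendsto_inv_natCast_pow (by omega)
  · simp only [slopeSeq, hi, if_false]
    exact tendsto_const_nhds

open Filter Topology in
theorem tendsto_constSeq (r d : ℕ) (b : Fin d → ℤ) :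
    Tendsto (constSeq r d b) atTop (𝓝 fun i => if (i : ℕ) < r then 1 else 0) := by
  refine tendsto_pi_nhds.2 fun i => ?_
  by_cases hi : (i : ℕ) < r
  · simp only [constSeq, hi, if_true]
    simpa using ((tendsto_inv_natCast_pow (n := 2 * (i : ℕ) + 4) (by omega)).const_mul
      (b i : ℝ)).const_sub 1
  · simp only [constSeq, hi, if_false]
    simpa using ((tendsto_inv_natCast_pow (n := 2) (by omega)).const_mul (b i : ℝ)).neg

open Polynomial in
theorem prodLinearAddOne_ite {R : Type*} [CommSemiring R] {r₁ r₂ d : ℕ} (hsig : r₁ + 2 * r₂ = d) :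
    prodLinearAddOne (fun i : Fin d => if (i : ℕ) < r₁ then (0 : R) else 1)
      (fun i => if (i : ℕ) < r₁ then 1 else 0) = X ^ (2 * r₂) + 1 := by
  have h (i : Fin d) : C (if (i : ℕ) < r₁ then (0 : R) else 1) * X +
      C (if (i : ℕ) < r₁ then (1 : R) else 0) = if (i : ℕ) < 0 ∨ r₁ ≤ (i : ℕ) then X else 1 := by
    by_cases hi : (i : ℕ) < r₁
    · simp [hi, hi.not_ge]
    · simp [hi, not_lt.1 hi]
  rw [prodLinearAddOne, Finset.prod_congr rfl fun i _ => h i, Finset.prod_ite, Finset.prod_const,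
    Finset.prod_const_one, card_filter_lt_or_le (Nat.zero_le _) (by omega), mul_one]
  congr 2
  omega

open Filter Topology in
theorem eventually_slopeSeq_mul_add_constSeq {r d k : ℕ} (b : Fin d → ℤ) (i : Fin d) (c : ℝ) :
    ∀ᶠ P : ℕ in atTop,
      (((i : ℕ) < k ∨ r ≤ (i : ℕ)) →
        slopeSeq r d P i * -(P : ℝ) ^ (2 * k + 1) + constSeq r d b P i ≤ c) ∧
      (¬((i : ℕ) < k ∨ r ≤ (i : ℕ)) →
        1 / 2 ≤ slopeSeq r d P i * -(P : ℝ) ^ (2 * k + 1) + constSeq r d b P i) := by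
  have hconst := tendsto_pi_nhds.1 (tendsto_constSeq r d b) i
  have hpow (n : ℕ) : Tendsto (fun P : ℕ => -(P : ℝ) ^ (n + 1)) atTop atBot :=
    tendsto_neg_atTop_atBot.comp
      ((tendsto_pow_atTop n.succ_ne_zero).comp (tendsto_natCast_atTop_atTop (R := ℝ)))
  by_cases hN : (i : ℕ) < k ∨ r ≤ (i : ℕ)
  · simp only [hN, true_imp_iff, not_true, false_imp_iff, and_true]
    obtain ⟨n, hn⟩ : ∃ n, ∀ᶠ P : ℕ in atTop,
        -(P : ℝ) ^ (n + 1) = slopeSeq r d P i * -(P : ℝ) ^ (2 * k + 1) := by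
      by_cases hi : (i : ℕ) < r
      · refine ⟨2 * (k - i - 1), ?_⟩
        filter_upwards [eventually_ne_atTop 0] with P hP
        have hP' : (P : ℝ) ≠ 0 := Nat.cast_ne_zero.2 hP
        have hk : 2 * k + 1 = (2 * (i : ℕ) + 2) + (2 * (k - i - 1) + 1) := by omega
        rw [slopeSeq, if_pos hi, hk, pow_add (P : ℝ) (2 * (i : ℕ) + 2), mul_neg, ← mul_assoc,
          ← mul_pow, inv_mul_cancel₀ hP', one_pow, one_mul]
      · refine ⟨2 * k, .of_forall fun P => ?_⟩
        rw [slopeSeq, if_neg hi, one_mul]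
    exact (((hpow n).congr' hn).atBot_add hconst).eventually_le_atBot c
  · simp only [hN, false_imp_iff, not_false_iff, true_imp_iff, true_and]
    push Not at hN
    have hev : ∀ᶠ P : ℕ in atTop, -(P : ℝ)⁻¹ ^ (2 * ((i : ℕ) - k) + 1) =
        slopeSeq r d P i * -(P : ℝ) ^ (2 * k + 1) := by
      filter_upwards [eventually_ne_atTop 0] with P hP
      have hP' : (P : ℝ) ≠ 0 := Nat.cast_ne_zero.2 hP
      have hk : 2 * (i : ℕ) + 2 = (2 * (i - k) + 1) + (2 * k + 1) := by omega
      rw [slopeSeq, if_pos hN.2, hk, pow_add (P : ℝ)⁻¹ _ (2 * k + 1), mul_neg, mul_assoc, ← mul_pow,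
        inv_mul_cancel₀ hP',
        one_pow, mul_one]
    have h0 := ((tendsto_inv_natCast_pow (n := 2 * ((i : ℕ) - k) + 1) (by omega)).neg.congr'
      hev).add hconst
    rw [if_pos hN.2] at h0
    exact h0.eventually_const_le (by norm_num)

open Filter Topology Polynomial in
theorem eventually_ncard_real_roots_prodLinearAddOne {d r₁ r₂ : ℕ} (hsig : r₁ + 2 * r₂ = d)
    (b : Fin d → ℤ) : ∀ᶠ P : ℕ in atTop,
      {x : ℝ | ∏ i, (slopeSeq r₁ d P i * x + constSeq r₁ d b P i) + 1 = 0}.ncard = r₁ := by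
  have hofReal : Continuous fun v : Fin d → ℝ => fun i => (v i : ℂ) := by fun_prop
  have hα := (hofReal.tendsto _).comp (tendsto_slopeSeq r₁ d)
  have hβ := (hofReal.tendsto _).comp (tendsto_constSeq r₁ d b)
  have hnon := eventually_exists_nonreal_roots (r := r₂) hα hβ (by
    rw [← prodLinearAddOne_ite hsig]
    congr 1 <;> ext i <;> split_ifs <;> simp)
  have hev : ∀ᶠ P : ℕ in atTop, ∀ k ∈ Finset.range (r₁ + 1), ∀ i : Fin d,
      _ ∧ _ := (eventually_all_finset _).2 fun k _ => eventually_all.2 fun i =>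
    eventually_slopeSeq_mul_add_constSeq (r := r₁) (k := k) b i (-2 ^ Fintype.card (Fin d))
  filter_upwards [hnon, hev, eventually_gt_atTop 1] with P ⟨g, hg, hgr⟩ hP hP1
  have hP1' : (1 : ℝ) < P := by exact_mod_cast hP1
  have hsign (k : ℕ) (hk : k ≤ r₁) : 0 < (-1) ^ k *
      (∏ i, (slopeSeq r₁ d P i * -(P : ℝ) ^ (2 * k + 1) + constSeq r₁ d b P i) + 1) := by
    have hcard := card_filter_lt_or_le (d := d) hk (by omega)
    refine neg_one_pow_mul_prod_add_one_pos
      (Finset.univ.filter fun i : Fin d => (i : ℕ) < k ∨ r₁ ≤ (i : ℕ)) (fun hk0 => ?_) ?_ ?_ ?_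
    · rw [← Finset.card_pos]
      omega
    · rw [hcard, ← hsig, Nat.add_sub_cancel_left, pow_add, pow_mul]
      simp
    · intro i hi
      exact (hP k (Finset.mem_range.2 (by omega)) i).1 (Finset.mem_filter.1 hi).2
    · intro i hi
      exact (hP k (Finset.mem_range.2 (by omega)) i).2 fun h =>
        hi (Finset.mem_filter.2 ⟨Finset.mem_univ i, h⟩)
  obtain ⟨a, ha, har⟩ := exists_injective_zeros (n := r₁)
    (F := fun x => ∏ i, (slopeSeq r₁ d P i * x + constSeq r₁ d b P i) + 1) (by fun_prop)
    (u := fun k => -(P : ℝ) ^ (2 * k + 1))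
    (fun k _ => neg_lt_neg (pow_lt_pow_right₀ hP1' (by omega))) hsign
  set p := prodLinearAddOne (slopeSeq r₁ d P) (constSeq r₁ d b P) with hp
  have heval (x : ℝ) : p.eval x = ∏ i, (slopeSeq r₁ d P i * x + constSeq r₁ d b P i) + 1 :=
    eval_prodLinearAddOne _ _ _
  have hmap : p.map Complex.ofRealHom = prodLinearAddOne (fun i => (slopeSeq r₁ d P i : ℂ))
      (fun i => (constSeq r₁ d b P i : ℂ)) := by
    simp [hp, prodLinearAddOne, Polynomial.map_prod]
  have hp0 : p ≠ 0 := by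
    intro h0
    have h := hsign 0 (Nat.zero_le _)
    rw [← heval, h0, eval_zero, mul_zero] at h
    exact h.false
  simp only [← heval]
  refine ncard_real_roots_eq hp0 ?_ ha (fun k => ?_) hg (fun k => ?_)
  · rw [hsig]
    simpa using natDegree_prodLinearAddOne_le (slopeSeq r₁ d P) (constSeq r₁ d b P)
  · rw [IsRoot.def, heval]
    exact har k
  · rw [hmap]
    exact hgr k

/-- The shifted roots `Aᵢ` of the polynomials with prescribed signature. -/
def shiftedRoot (r d : ℕ) (b : Fin d → ℤ) (P : ℕ) (i : Fin d) : ℤ :=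
  b i - if (i : ℕ) < r then (P : ℤ) ^ (2 * (i : ℕ) + 4) else 0

/-- The exponent of `P` in the constant term of the polynomials with prescribed signature. -/
def shiftExponent (r d : ℕ) : ℕ :=
  ∑ i : Fin d, if (i : ℕ) < r then 2 * (i : ℕ) + 4 else 2

open Filter in
theorem eventually_ncard_real_roots_shiftedRoot {d r₁ r₂ : ℕ} (hsig : r₁ + 2 * r₂ = d)
    (b : Fin d → ℤ) : ∀ᶠ P : ℕ in atTop,
      {x : ℝ | ∏ i, (x - (shiftedRoot r₁ d b P i : ℝ)) + (P : ℝ) ^ shiftExponent r₁ d = 0}.ncard =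
        r₁ := by
  filter_upwards [eventually_ncard_real_roots_prodLinearAddOne hsig b, eventually_ne_atTop 0]
    with P hP hP0
  have hP' : (P : ℝ) ≠ 0 := Nat.cast_ne_zero.2 hP0
  have hfac (x : ℝ) (i : Fin d) : (P : ℝ) ^ 2 * x - (shiftedRoot r₁ d b P i : ℝ) =
      (P : ℝ) ^ (if (i : ℕ) < r₁ then 2 * (i : ℕ) + 4 else 2) *
        (slopeSeq r₁ d P i * x + constSeq r₁ d b P i) := by
    by_cases hi : (i : ℕ) < r₁
    · simp only [shiftedRoot, slopeSeq, constSeq, hi, if_true]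
      have h2 : (P : ℝ) ^ (2 * (i : ℕ) + 4) * (P : ℝ)⁻¹ ^ (2 * (i : ℕ) + 2) = P ^ 2 := by
        rw [show 2 * (i : ℕ) + 4 = 2 + (2 * i + 2) by ring, pow_add, mul_assoc, ← mul_pow,
          mul_inv_cancel₀ hP', one_pow, mul_one]
      have h4 : (P : ℝ) ^ (2 * (i : ℕ) + 4) * (P : ℝ)⁻¹ ^ (2 * (i : ℕ) + 4) = 1 := by
        rw [← mul_pow, mul_inv_cancel₀ hP', one_pow]
      push_cast
      linear_combination -x * h2 + (b i : ℝ) * h4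
    · simp only [shiftedRoot, slopeSeq, constSeq, hi, if_false]
      push_cast
      field_simp
      ring
  have heq (x : ℝ) : ∏ i, ((P : ℝ) ^ 2 * x - (shiftedRoot r₁ d b P i : ℝ)) +
      (P : ℝ) ^ shiftExponent r₁ d = (P : ℝ) ^ shiftExponent r₁ d *
        (∏ i, (slopeSeq r₁ d P i * x + constSeq r₁ d b P i) + 1) := by
    rw [Finset.prod_congr rfl fun i _ => hfac x i, Finset.prod_mul_distrib,
      Finset.prod_pow_eq_pow_sum, ← shiftExponent]
    ring
  have hinj : Function.Injective fun x : ℝ => (P : ℝ) ^ 2 * x :=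
    mul_right_injective₀ (pow_ne_zero 2 hP')
  refine Eq.trans ?_ ((Set.ncard_image_of_injective _ hinj).trans hP)
  congr 1
  ext y
  constructor
  · intro hy
    refine ⟨y / (P : ℝ) ^ 2, ?_, by field_simp⟩
    have h := heq (y / (P : ℝ) ^ 2)
    rw [mul_div_cancel₀ y (pow_ne_zero 2 hP')] at h
    rw [Set.mem_ofPred_eq, h] at hy
    exact (mul_eq_zero.1 hy).resolve_left (pow_ne_zero _ hP')
  · rintro ⟨x, hx, rfl⟩
    simp only [Set.mem_ofPred_eq] at hx ⊢
    rw [heq, hx, mul_zero]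

open Polynomial in
/-- The polynomial `∏ᵢ (X - Aᵢ) + c`. -/
noncomputable def shiftedProd {ι : Type*} [Fintype ι] (A : ι → ℤ) (c : ℤ) : ℤ[X] :=
  ∏ i, (X - C (A i)) + C c

open Polynomial in
theorem aeval_shiftedProd {ι R : Type*} [Fintype ι] [CommRing R] (A : ι → ℤ) (c : ℤ) (x : R) :
    aeval x (shiftedProd A c) = ∏ i, (x - A i) + c := by
  simp [shiftedProd, map_prod]

/-- Arithmetic conditions on `A` and `c` under which the differences `θ - Aᵢ`, for a root `θ` of
`∏ᵢ (X - Aᵢ) + c ^ m`, yield independent elements of the class group. -/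
structure IsIndependentShift (m n : ℕ) (A : Fin (n + 1) → ℤ) (c : ℤ) : Prop where
  ne_zero : c ≠ 0
  isCoprime : ∀ i j, i ≠ j → IsCoprime (A i - A j) c
  exists_prime : ∀ j : Fin n, ∃ (p : ℕ) (_ : Fact p.Prime) (g : (ZMod p)ˣ),
    m * (2 * (n + 1)).factorial ∣ p - 1 ∧ orderOf g = p - 1 ∧
    (((shiftedProd A (c ^ m)).eval 0 : ℤ) : ZMod p) = 0 ∧
    (((shiftedProd A (c ^ m)).derivative.eval 0 : ℤ) : ZMod p) ≠ 0 ∧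
    ∀ i : Fin n, -(A i.castSucc : ZMod p) = ((if i = j then g else 1 : (ZMod p)ˣ) : ZMod p)

open Polynomial in
theorem IsIndependentShift.exists_injective {K : Type*} [Field K] [NumberField K] {m n k : ℕ}
    {A : Fin (n + 1) → ℤ} {c : ℤ} (hA : IsIndependentShift m n A c) (hm : 0 < m)
    (pb : PowerBasis ℚ K)
    (hpb : minpoly ℚ pb.gen = (shiftedProd A (c ^ m)).map (Int.castRingHom ℚ))
    (hK : Module.finrank ℚ K = n + 1) (hk : k + Units.rank K ≤ n) :
    ∃ f : (Fin k → ZMod m) →+ Additive (ClassGroup (𝓞 K)), Function.Injective f := by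
  have hroot : aeval pb.gen (shiftedProd A (c ^ m)) = 0 := by
    have h := minpoly.aeval ℚ pb.gen
    rw [hpb] at h
    change aeval _ ((shiftedProd A (c ^ m)).map (algebraMap ℤ ℚ)) = 0 at h
    rwa [aeval_map_algebraMap] at h
  have hint : IsIntegral ℤ pb.gen := by
    refine ⟨shiftedProd A (c ^ m), ?_, hroot⟩
    have h := minpoly.monic pb.isIntegral_gen
    rw [hpb] at h
    exact (Function.Injective.monic_map_iff (Int.castRingHom ℚ).injective_int).2 h
  obtain ⟨θ, hθ⟩ : ∃ θ : 𝓞 K, (θ : K) = pb.gen := ⟨⟨pb.gen, hint⟩, rfl⟩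
  have hprod : ∏ i, (θ - (A i : 𝓞 K)) = -(c : 𝓞 K) ^ m := by
    have h : ∏ i, (θ - (A i : 𝓞 K)) + (c : 𝓞 K) ^ m = 0 := by
      apply RingOfIntegers.coe_injective
      rw [aeval_shiftedProd, ← hθ] at hroot
      simpa using hroot
    exact eq_neg_of_add_eq_zero_left h
  have hcop (i j : Fin (n + 1)) (hij : i ≠ j) :
      IsCoprime (θ - (A i : 𝓞 K)) (θ - (A j : 𝓞 K)) := by
    have h1 : IsCoprime ((A i - A j : ℤ) : 𝓞 K) (c : 𝓞 K) :=
      (hA.isCoprime i j hij).map (Int.castRingHom (𝓞 K))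
    have h2 : θ - (A i : 𝓞 K) ∣ (c : 𝓞 K) ^ m := by
      rw [← dvd_neg, ← hprod]
      exact Finset.dvd_prod_of_mem _ (Finset.mem_univ i)
    have h3 := (h1.pow_right (n := m)).of_isCoprime_of_dvd_right h2
    have h4 : θ - (A j : 𝓞 K) = ((A i - A j : ℤ) : 𝓞 K) + (θ - (A i : 𝓞 K)) * 1 := by
      push_cast
      ring
    rw [h4, IsCoprime.add_mul_left_right_iff]
    exact h3.symm
  have hne (i : Fin (n + 1)) : ((θ - (A i : 𝓞 K) : 𝓞 K) : K) ≠ 0 := by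
    rw [RingOfIntegers.coe_ne_zero_iff]
    refine fun h => pow_ne_zero m (Int.cast_ne_zero.2 hA.ne_zero)
      (neg_eq_zero.1 (hprod.symm.trans ?_))
    exact Finset.prod_eq_zero (Finset.mem_univ i) h
  let x (i : Fin n) : Kˣ := Units.mk0 _ (hne i.castSucc)
  have hJ (i : Fin n) := exists_fractionalIdeal_pow_eq (K := K) hm.ne' _ _ hcop hprod i.castSucc
    (x i) rfl
  choose J hJ using hJ
  refine exists_injective_classGroup hk x J hJ fun e ζ y hζ h j => ?_
  obtain ⟨p, _, g, hp, hg, h0, h1, hres⟩ := hA.exists_prime j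
  obtain ⟨σ, t, hσ, ht⟩ := exists_padic_embedding pb _ hpb h0 h1
  have hζ' : ζ ^ (2 * (n + 1)).factorial = 1 := by
    have h2 := pow_factorial_two_mul_finrank_eq_one (K := K) (ζ := ζ)
      ((Units.coeHom K).isOfFinOrder hζ)
    rw [hK] at h2
    exact Units.ext (by simpa using h2)
  refine dvd_exponent_of_residues hm hp σ x (fun i => t - (A i.castSucc : ℤ_[p])) (fun i => ?_)
    j g hg (fun i => ?_) e ζ y hζ' h
  · simp [x, hθ, hσ]
  · rw [map_sub, ht, map_intCast, zero_sub, hres]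

theorem exists_int_forall_modEq {ι : Type*} [Finite ι] {N : ι → ℤ}
    (hN : Pairwise (Function.onFun IsCoprime N)) (v : ι → ℤ) :
    ∃ b : ℤ, ∀ x, b ≡ v x [ZMOD N x] := by
  obtain ⟨b, hb⟩ := Ideal.exists_forall_sub_mem_ideal (R := ℤ) (I := fun x => Ideal.span {N x})
    (fun x y hxy => (Ideal.isCoprime_span_singleton_iff _ _).2 (hN hxy)) v
  exact ⟨b, fun x => (Int.modEq_iff_dvd.2 (Ideal.mem_span_singleton.1 (hb x))).symm⟩

/-- Polynomials `∏ᵢ (X - Aᵢ) + c ^ m` with prescribed residues and prescribed number of real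
roots. -/
theorem exists_shift_of_residues {ι : Type*} [Finite ι] {N : ι → ℕ} (hN0 : ∀ x, N x ≠ 0)
    (hN : Pairwise (Function.onFun Nat.Coprime N)) {m d r₁ r₂ : ℕ} (hm : 0 < m)
    (hsig : r₁ + 2 * r₂ = d) (v : ι → Fin d → ℤ) :
    ∃ (A : Fin d → ℤ) (c : ℤ), c ≠ 0 ∧ (∀ i j, i ≠ j → IsCoprime (A i - A j) c) ∧
      (∀ x, c ≡ 1 [ZMOD N x]) ∧ (∀ x i, A i ≡ v x i [ZMOD N x]) ∧
      {t : ℝ | Polynomial.aeval t (shiftedProd A (c ^ m)) = 0}.ncard = r₁ := by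
  have := Fintype.ofFinite ι
  obtain ⟨q, hq, hdq, hqN⟩ := Nat.exists_prime_gt_modEq_one (k := ∏ x, N x) d
    (Finset.prod_ne_zero_iff.2 fun x _ => hN0 x)
  have hq1 (x : ι) : (q : ℤ) ≡ 1 [ZMOD N x] :=
    mod_cast (Int.natCast_modEq_iff.2 hqN).of_dvd
      (Int.natCast_dvd_natCast.2 (Finset.dvd_prod_of_mem N (Finset.mem_univ x)))
  have hqc (x : ι) : IsCoprime (q : ℤ) (N x : ℤ) := by
    obtain ⟨t, ht⟩ := (hq1 x).symm.dvd
    exact ⟨1, -t, by linear_combination ht⟩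
  have hb (i : Fin d) : ∃ b : ℤ, b ≡ i [ZMOD q] ∧
      ∀ x, b ≡ v x i + (if (i : ℕ) < r₁ then 1 else 0) [ZMOD N x] := by
    obtain ⟨b, hb⟩ := exists_int_forall_modEq (ι := Option ι)
      (N := fun o => o.elim (q : ℤ) fun x => (N x : ℤ))
      (by
        rintro (_ | x) (_ | y) hxy
        · exact absurd rfl hxy
        · exact hqc y
        · exact (hqc x).symm
        · exact Nat.isCoprime_iff_coprime.2 (hN fun h => hxy (congrArg some h)))
      (fun o => o.elim (i : ℤ) fun x => v x i + (if (i : ℕ) < r₁ then 1 else 0))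
    exact ⟨b, hb none, fun x => hb (some x)⟩
  choose b hbq hbN using hb
  have htend : Filter.Tendsto (fun e : ℕ => q ^ (m * e)) Filter.atTop Filter.atTop :=
    (tendsto_pow_atTop_atTop_of_one_lt hq.one_lt).comp
      (Filter.tendsto_id.const_mul_atTop' hm)
  obtain ⟨e, he, he0⟩ := ((htend.eventually
    (eventually_ncard_real_roots_shiftedRoot hsig b)).and (Filter.eventually_ne_atTop 0)).exists
  have hq0 : (q : ℤ) ≠ 0 := Int.natCast_ne_zero.2 hq.ne_zero
  refine ⟨shiftedRoot r₁ d b (q ^ (m * e)), (q : ℤ) ^ (e * shiftExponent r₁ d),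
    pow_ne_zero _ hq0, fun i j hij => IsCoprime.pow_right ?_, fun x => ?_, fun x i => ?_, ?_⟩
  · have hA (i : Fin d) : shiftedRoot r₁ d b (q ^ (m * e)) i ≡ i [ZMOD q] := by
      rw [← sub_zero (i : ℤ)]
      refine (hbq i).sub ?_
      split_ifs
      · rw [Int.modEq_zero_iff_dvd]
        push_cast
        exact dvd_pow (dvd_pow_self _ (mul_ne_zero hm.ne' he0)) (by omega)
      · rfl
    refine ((Nat.prime_iff_prime_int.1 hq).coprime_iff_not_dvd.2 fun h => hij ?_).symm
    have h1 := (((hA i).sub (hA j)).dvd_iff).1 h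
    have h2 := Int.eq_zero_of_abs_lt_dvd h1 (by rw [abs_lt]; omega)
    exact Fin.ext (by omega)
  · simpa using (hq1 x).pow (e * shiftExponent r₁ d)
  · have h := (hbN i x).sub (show (if (i : ℕ) < r₁ then ((q ^ (m * e) : ℕ) : ℤ) ^ (2 * (i : ℕ) + 4)
      else 0) ≡ (if (i : ℕ) < r₁ then 1 else 0) [ZMOD N x] by
        split_ifs
        · push_cast
          simpa using ((hq1 x).pow (m * e)).pow (2 * (i : ℕ) + 4)
        · rfl)
    rwa [add_sub_cancel_right] at h
  · convert he using 5 with t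
    rw [aeval_shiftedProd]
    push_cast
    simp only [← pow_mul]
    congr 2
    ring

open Polynomial in
theorem map_shiftedProd {ι R : Type*} [Fintype ι] [CommRing R] (A : ι → ℤ) (c : ℤ) :
    (shiftedProd A c).map (Int.castRingHom R) = ∏ i, (X - C (A i : R)) + C (c : R) := by
  simp [shiftedProd, Polynomial.map_prod]

open Polynomial in
theorem eval_shiftedProd {ι : Type*} [Fintype ι] (A : ι → ℤ) (c x : ℤ) :
    (shiftedProd A c).eval x = ∏ i, (x - A i) + c := by
  simp [shiftedProd, eval_prod]

open Polynomial in
theorem cast_eval_zero_derivative_shiftedProd {ι F : Type*} [Fintype ι] [Field F] {A : ι → ℤ}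
    (c : ℤ) {u : ι → F} (hu : ∀ i, u i ≠ 0) (hA : ∀ i, -(A i : F) = u i) :
    (((shiftedProd A c).derivative.eval 0 : ℤ) : F) = (∏ i, u i) * ∑ i, (u i)⁻¹ := by
  classical
  simp only [shiftedProd, derivative_add, derivative_prod_finset, derivative_C, add_zero,
    eval_finsetSum, eval_prod, derivative_sub, derivative_X, sub_zero, mul_one, eval_sub, eval_X,
    eval_C, zero_sub, Int.cast_sum, Int.cast_prod, Int.cast_neg, hA, Finset.mul_sum]
  refine Finset.sum_congr rfl fun i _ => ?_
  rw [← Finset.mul_prod_erase _ _ (Finset.mem_univ i), mul_comm (u i), mul_assoc,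
    mul_inv_cancel₀ (hu i), mul_one]

theorem exists_orderOf_eq_and_add_inv_sub_ne_zero {n p : ℕ} [Fact p.Prime] (hn : 0 < n)
    (hp : 2 * n + 2 < p) : ∃ g : (ZMod p)ˣ, orderOf g = p - 1 ∧
      (n : ZMod p) - 1 + (g : ZMod p)⁻¹ - g ≠ 0 := by
  obtain ⟨g, hg⟩ := IsCyclic.exists_ofOrder_eq_natCard (α := (ZMod p)ˣ)
  rw [Nat.card_eq_fintype_card, ZMod.card_units] at hg
  by_contra! h
  have h1 := h g hg
  have h2 := h g⁻¹ (by rwa [orderOf_inv])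
  rw [Units.val_inv_eq_inv_val, inv_inv] at h2
  have h3 : ((2 * (n - 1) : ℕ) : ZMod p) = 0 := by
    push_cast [Nat.cast_sub (show 1 ≤ n from hn)]
    linear_combination h1 + h2
  rw [ZMod.natCast_eq_zero_iff] at h3
  have h4 := Nat.eq_zero_of_dvd_of_lt h3 (by omega)
  obtain rfl : n = 1 := by omega
  have h5 : g ^ 2 = 1 := by
    ext
    have h6 : (g : ZMod p)⁻¹ * g = 1 := inv_mul_cancel₀ g.ne_zero
    push_cast at h1 ⊢
    linear_combination h6 - g * h1
  have h7 := Nat.le_of_dvd two_pos (orderOf_dvd_of_pow_eq_one h5)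
  omega

/-- Residues modulo `p` realizing the condition in `IsIndependentShift`. -/
theorem exists_residues_of_lt {n p : ℕ} [Fact p.Prime] (hn : 0 < n) (hp : 2 * n + 2 < p)
    (j : Fin n) : ∃ (g : (ZMod p)ˣ) (v : Fin (n + 1) → ℤ), orderOf g = p - 1 ∧
      ∀ (A : Fin (n + 1) → ℤ) (c : ℤ), (∀ i, A i ≡ v i [ZMOD p]) → c ≡ 1 [ZMOD p] →
        (((shiftedProd A c).eval 0 : ℤ) : ZMod p) = 0 ∧
        (((shiftedProd A c).derivative.eval 0 : ℤ) : ZMod p) ≠ 0 ∧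
        ∀ i : Fin n, -(A i.castSucc : ZMod p) =
          ((if i = j then g else 1 : (ZMod p)ˣ) : ZMod p) := by
  obtain ⟨g, hg, hne⟩ := exists_orderOf_eq_and_add_inv_sub_ne_zero (p := p) hn hp
  let u : Fin (n + 1) → (ZMod p)ˣ := Fin.snoc (fun i : Fin n => if i = j then g else 1) (-g⁻¹)
  have huc (i : Fin n) : u i.castSucc = if i = j then g else 1 := Fin.snoc_castSucc ..
  have hul : u (Fin.last n) = -g⁻¹ := Fin.snoc_last ..
  refine ⟨g, fun i => ((-(u i : ZMod p)).val : ℤ), hg, fun A c hA hc => ?_⟩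
  have hA' (i : Fin (n + 1)) : -(A i : ZMod p) = u i := by
    have h := (ZMod.intCast_eq_intCast_iff _ _ _).2 (hA i)
    rw [h]
    simp
  have hc' : (c : ZMod p) = 1 := by
    simpa using (ZMod.intCast_eq_intCast_iff _ _ _).2 hc
  have hprod : ∏ i, (u i : ZMod p) = -1 := by
    rw [← Units.coe_prod, Fin.prod_univ_castSucc, hul, Finset.prod_congr rfl fun i _ => huc i,
      Finset.prod_ite_eq' _ _ (fun _ => g)]
    simp
  refine ⟨?_, ?_, fun i => by rw [hA', huc]⟩
  · rw [eval_shiftedProd]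
    push_cast
    simp [hA', hprod, hc']
  · rw [cast_eval_zero_derivative_shiftedProd c (fun i => (u i).ne_zero) hA', hprod]
    refine mul_ne_zero (neg_ne_zero.2 one_ne_zero) ?_
    convert hne using 1
    rw [Fin.sum_univ_castSucc, hul]
    simp only [huc]
    rw [← Finset.add_sum_erase _ _ (Finset.mem_univ j), if_pos rfl,
      Finset.sum_congr rfl (g := fun _ => (1 : ZMod p)) fun i hi => by
        simp [Finset.ne_of_mem_erase hi]]
    simp only [Finset.sum_const, Finset.card_erase_of_mem (Finset.mem_univ j), Finset.card_univ,
      Fintype.card_fin, nsmul_eq_mul, mul_one, Nat.cast_sub (show 1 ≤ n from hn), Units.val_neg,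
      Units.val_inv_eq_inv_val, inv_neg, inv_inv, Nat.cast_one]
    ring

open Polynomial in
theorem exists_prod_X_sub_C_add_one_eq {d ℓ : ℕ} [Fact ℓ.Prime] (hd : 0 < d) (hℓ : d ∣ ℓ - 1) :
    ∃ z : Fin d → ZMod ℓ, ∏ i, (X - C (z i)) + 1 = (X ^ d : (ZMod ℓ)[X]) := by
  obtain ⟨g, hg⟩ := IsCyclic.exists_ofOrder_eq_natCard (α := (ZMod ℓ)ˣ)
  rw [Nat.card_eq_fintype_card, ZMod.card_units] at hg
  have hprim : IsPrimitiveRoot (g : ZMod ℓ) (ℓ - 1) := by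
    rw [IsPrimitiveRoot.coe_units_iff, ← hg]
    exact IsPrimitiveRoot.orderOf g
  obtain ⟨k, hk⟩ := hℓ
  have hζ := hprim.pow (Nat.sub_pos_of_lt (Fact.out : ℓ.Prime).one_lt) (a := k) (b := d)
    (by rw [hk, mul_comm])
  have e := (Finset.equivFinOfCardEq hζ.card_nthRootsFinset).symm
  refine ⟨fun i => e i, ?_⟩
  rw [← sub_add_cancel (X ^ d : (ZMod ℓ)[X]) 1, X_pow_sub_one_eq_prod hd hζ,
    ← Finset.prod_coe_sort (nthRootsFinset d 1)]
  exact congrArg (· + 1) (Fintype.prod_equiv e _ _ fun i => rfl)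

open Polynomial in
/-- Residues modulo `ℓ ^ 2` making `∏ᵢ (X - Aᵢ) + c` an Eisenstein polynomial at `ℓ`. -/
theorem exists_residues_eisenstein {n ℓ : ℕ} (hℓ : ℓ.Prime) (hn : n + 1 ∣ ℓ - 1) :
    ∃ v : Fin (n + 1) → ℤ, ∀ (A : Fin (n + 1) → ℤ) (c : ℤ), (∀ i, A i ≡ v i [ZMOD (ℓ ^ 2 : ℕ)]) →
      c ≡ 1 [ZMOD (ℓ ^ 2 : ℕ)] →
        (shiftedProd A c).map (Int.castRingHom (ZMod ℓ)) = X ^ (n + 1) ∧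
        ¬ (ℓ : ℤ) ^ 2 ∣ (shiftedProd A c).eval 0 := by
  have : Fact ℓ.Prime := ⟨hℓ⟩
  obtain ⟨z, hz⟩ := exists_prod_X_sub_C_add_one_eq (Nat.succ_pos n) hn
  have hz0 (i : Fin (n + 1)) : z i ≠ 0 := by
    intro h
    have h1 := congrArg (eval (z i)) hz
    rw [eval_add, eval_prod, Finset.prod_eq_zero (Finset.mem_univ i) (by simp)] at h1
    simp [h] at h1
  obtain ⟨v, hvz, hv⟩ : ∃ v : Fin (n + 1) → ℤ, (∀ i, (v i : ZMod ℓ) = z i) ∧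
      ¬ (ℓ : ℤ) ^ 2 ∣ ∏ i, (0 - v i) + 1 := by
    let a (i : Fin (n + 1)) : ℤ := (z i).val
    have ha (i : Fin (n + 1)) : (a i : ZMod ℓ) = z i := by simp [a]
    by_cases h : (ℓ : ℤ) ^ 2 ∣ ∏ i, (0 - a i) + 1
    · refine ⟨Fin.cons (a 0 + ℓ) fun i => a i.succ,
        Fin.cases (by simp [ha]) fun i => by simp [ha], fun h' => ?_⟩
      have h2 := dvd_sub h h'
      simp only [Fin.prod_univ_succ, Fin.cons_zero, Fin.cons_succ] at h2
      rw [show (0 - a 0) * ∏ i : Fin n, (0 - a i.succ) + 1 -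
        ((0 - (a 0 + ℓ)) * ∏ i : Fin n, (0 - a i.succ) + 1) = ℓ * ∏ i : Fin n, (0 - a i.succ) by
          ring, sq] at h2
      have h3 := Int.dvd_of_mul_dvd_mul_left (Int.natCast_ne_zero.2 hℓ.ne_zero) h2
      rw [← ZMod.intCast_zmod_eq_zero_iff_dvd] at h3
      push_cast at h3
      obtain ⟨i, -, hi⟩ := Finset.prod_eq_zero_iff.1 h3
      simp [ha, hz0] at hi
    · exact ⟨a, ha, h⟩
  refine ⟨v, fun A c hA hc => ⟨?_, ?_⟩⟩
  · have hℓ2 : (ℓ : ℤ) ∣ (ℓ ^ 2 : ℕ) := by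
      push_cast
      exact dvd_pow_self _ two_ne_zero
    have hA' (i : Fin (n + 1)) : (A i : ZMod ℓ) = z i := by
      rw [← hvz, ZMod.intCast_eq_intCast_iff]
      exact (hA i).of_dvd hℓ2
    have hc' : (c : ZMod ℓ) = 1 := by
      simpa using (ZMod.intCast_eq_intCast_iff _ _ _).2 (hc.of_dvd hℓ2)
    rw [map_shiftedProd, hc', C_1, ← hz]
    simp only [hA']
  · rw [eval_shiftedProd]
    have h : ∏ i, (0 - A i) + c ≡ ∏ i, (0 - v i) + 1 [ZMOD (ℓ ^ 2 : ℕ)] :=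
      (Int.ModEq.prod fun i _ => (Int.ModEq.refl 0).sub (hA i)).add hc
    push_cast at h
    rwa [h.dvd_iff]

/-- Existence of Eisenstein polynomials `∏ᵢ (X - Aᵢ) + c ^ m` with prescribed number of real roots
and satisfying `IsIndependentShift`. -/
theorem exists_isIndependentShift {m n r₁ r₂ : ℕ} (hm : 0 < m) (hn : 0 < n)
    (hsig : r₁ + 2 * r₂ = n + 1) (L : ℕ) :
    ∃ (A : Fin (n + 1) → ℤ) (c : ℤ) (ℓ : ℕ), ℓ.Prime ∧ L < ℓ ∧ IsIndependentShift m n A c ∧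
      (shiftedProd A (c ^ m)).map (Int.castRingHom (ZMod ℓ)) = Polynomial.X ^ (n + 1) ∧
      ¬ (ℓ : ℤ) ^ 2 ∣ (shiftedProd A (c ^ m)).eval 0 ∧
      {t : ℝ | Polynomial.aeval t (shiftedProd A (c ^ m)) = 0}.ncard = r₁ := by
  have hk : m * (2 * (n + 1)).factorial ≠ 0 := mul_ne_zero hm.ne' (Nat.factorial_ne_zero _)
  have hinf := (Nat.infinite_setOfPred_prime_modEq_one hk).sdiff
    (Set.finite_Iic (max L (2 * n + 2)))
  let φ (x : Fin (n + 1)) : ℕ := Set.Infinite.natEmbedding _ hinf x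
  have hφ (x : Fin (n + 1)) : ((φ x).Prime ∧ φ x ≡ 1 [MOD m * (2 * (n + 1)).factorial]) ∧
      max L (2 * n + 2) < φ x := by
    have h := (Set.Infinite.natEmbedding _ hinf x).2
    exact ⟨h.1, not_le.1 h.2⟩
  have hφinj : Function.Injective φ := fun x y h =>
    Fin.ext ((Set.Infinite.natEmbedding _ hinf).injective (Subtype.ext h))
  have hdvd (x : Fin (n + 1)) : m * (2 * (n + 1)).factorial ∣ φ x - 1 :=
    (Nat.modEq_iff_dvd' (hφ x).1.1.one_le).1 (hφ x).1.2.symm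
  have hprime (x : Fin (n + 1)) : Fact (φ x).Prime := ⟨(hφ x).1.1⟩
  have hlt (x : Fin (n + 1)) : 2 * n + 2 < φ x := (le_max_right _ _).trans_lt (hφ x).2
  obtain ⟨v₀, hv₀⟩ := exists_residues_eisenstein (n := n) (hφ 0).1.1
    (((Nat.dvd_factorial (Nat.succ_pos n) (by omega)).mul_left m).trans (hdvd 0))
  choose g v hg hv using fun j : Fin n => exists_residues_of_lt (p := φ j.succ) hn (hlt _) j
  obtain ⟨A, c, hc, hcop, hcN, hAN, hcard⟩ := exists_shift_of_residues
    (N := fun x => φ x ^ 2) (fun x => pow_ne_zero 2 (hφ x).1.1.ne_zero)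
    (fun x y hxy => Nat.Coprime.pow 2 2
      ((Nat.coprime_primes (hφ x).1.1 (hφ y).1.1).2 fun h => hxy (hφinj h)))
    hm hsig (Fin.cons v₀ v)
  have hcm (x : Fin (n + 1)) : c ^ m ≡ 1 [ZMOD (φ x ^ 2 : ℕ)] := by simpa using (hcN x).pow m
  obtain ⟨h1, h2⟩ := hv₀ A (c ^ m) (hAN 0) (hcm 0)
  refine ⟨A, c, φ 0, (hφ 0).1.1, (le_max_left _ _).trans_lt (hφ 0).2, ⟨hc, hcop, fun j => ?_⟩,
    h1, h2, hcard⟩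
  have hsq : (φ j.succ : ℤ) ∣ (φ j.succ ^ 2 : ℕ) :=
    Int.natCast_dvd_natCast.2 (dvd_pow_self _ two_ne_zero)
  exact ⟨φ j.succ, hprime _, g j, hdvd _, hg j,
    hv j A (c ^ m) (fun i => (hAN j.succ i).of_dvd hsq) ((hcm j.succ).of_dvd hsq)⟩

open Polynomial in
theorem monic_shiftedProd {n : ℕ} (A : Fin (n + 1) → ℤ) (c : ℤ) : (shiftedProd A c).Monic := by
  refine (monic_prod_X_sub_C A Finset.univ).add_of_left
    (degree_C_le.trans_lt (natDegree_pos_iff_degree_pos.1 ?_))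
  rw [natDegree_finsetProd_X_sub_C_eq_card]
  simp

open Polynomial in
theorem natDegree_shiftedProd {n : ℕ} (A : Fin (n + 1) → ℤ) (c : ℤ) :
    (shiftedProd A c).natDegree = n + 1 := by
  rw [shiftedProd, natDegree_add_C, natDegree_finsetProd_X_sub_C_eq_card]
  simp

open Polynomial in
theorem exists_eq_X_pow_add_of_map_eq {f : ℤ[X]} {ℓ d : ℕ}
    (h : f.map (Int.castRingHom (ZMod ℓ)) = X ^ d) : ∃ g : ℤ[X], f = X ^ d + C (ℓ : ℤ) * g := by
  have h1 : C (ℓ : ℤ) ∣ f - X ^ d := by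
    rw [C_dvd_iff_dvd_coeff]
    intro i
    rw [← ZMod.intCast_zmod_eq_zero_iff_dvd, ← eq_intCast (Int.castRingHom (ZMod ℓ)), ← coeff_map]
    simp [h]
  obtain ⟨g, hg⟩ := h1
  exact ⟨g, by rw [← hg, add_sub_cancel]⟩

open Polynomial in
theorem irreducible_of_map_eq_X_pow {f : ℤ[X]} {ℓ d : ℕ} (hℓ : ℓ.Prime) (hf : f.Monic)
    (hd : f.natDegree = d) (hd0 : 0 < d) (h : f.map (Int.castRingHom (ZMod ℓ)) = X ^ d)
    (h0 : ¬ (ℓ : ℤ) ^ 2 ∣ f.eval 0) : Irreducible f := by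
  have hprime : Prime (ℓ : ℤ) := Nat.prime_iff_prime_int.1 hℓ
  have hdeg : f.degree = d := by rw [degree_eq_natDegree hf.ne_zero, hd]
  refine irreducible_of_eisenstein_criterion (P := Ideal.span {(ℓ : ℤ)})
    ((Ideal.span_singleton_prime hprime.ne_zero).2 hprime) ?_ (fun i hi => ?_)
    (by rw [hdeg]; exact_mod_cast hd0) ?_ hf.isPrimitive
  · rw [hf.leadingCoeff, Ideal.mem_span_singleton]
    exact fun h => hprime.not_isUnit (isUnit_of_dvd_one h)
  · rw [Ideal.mem_span_singleton, ← ZMod.intCast_zmod_eq_zero_iff_dvd,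
      ← eq_intCast (Int.castRingHom (ZMod ℓ)), ← coeff_map, h, coeff_X_pow, if_neg]
    rw [hdeg] at hi
    exact (Nat.cast_lt.1 hi).ne
  · rwa [Ideal.span_singleton_pow, Ideal.mem_span_singleton, coeff_zero_eq_eval_zero]

open Polynomial in
theorem dvd_discr_of_map_eq_X_pow {K : Type*} [Field K] [NumberField K] {f : ℤ[X]} {ℓ d : ℕ}
    (hℓ : ℓ.Prime) (hd : 2 ≤ d) (h : f.map (Int.castRingHom (ZMod ℓ)) = X ^ d)
    (h0 : ¬ (ℓ : ℤ) ^ 2 ∣ f.eval 0) {θ : 𝓞 K} (hθ : aeval θ f = 0) : (ℓ : ℤ) ∣ discr K := by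
  obtain ⟨g, rfl⟩ := exists_eq_X_pow_add_of_map_eq h
  refine dvd_discr_of_eisenstein hℓ θ d hd (-aeval θ g.divX) (-g.coeff 0) (fun hg => h0 ?_) ?_
  · rw [dvd_neg, coeff_zero_eq_eval_zero] at hg
    rw [eval_add, eval_pow, eval_X, zero_pow (by omega), zero_add, eval_mul, eval_C, sq]
    exact mul_dvd_mul_left _ hg
  · have h2 := congrArg (aeval θ) g.X_mul_divX_add
    simp only [map_add, map_mul, map_pow, aeval_X, map_natCast, map_intCast, eq_intCast] at h2 hθ
    push_cast
    linear_combination hθ + (ℓ : 𝓞 K) * h2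

/-- Number fields of given signature with large class group and a large ramified prime. -/
theorem exists_subfield_complex {m n r₁ r₂ : ℕ} (hm : 0 < m) (hn : 0 < n)
    (hsig : r₁ + 2 * r₂ = n + 1) (L : ℕ) :
    ∃ (K : Subfield ℂ) (_ : NumberField K) (ℓ : ℕ), L < ℓ ∧ (ℓ : ℤ) ∣ discr K ∧
      Module.finrank ℚ K = n + 1 ∧ InfinitePlace.nrRealPlaces K = r₁ ∧
      InfinitePlace.nrComplexPlaces K = r₂ ∧
      ∃ f : (Fin r₂ → ZMod m) →+ Additive (ClassGroup (𝓞 K)), Function.Injective f := by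
  obtain ⟨A, c, ℓ, hℓ, hL, hA, hmap, h0, hcard⟩ := exists_isIndependentShift hm hn hsig L
  set f := shiftedProd A (c ^ m) with hf
  have hmonic : f.Monic := monic_shiftedProd A _
  have hdeg : f.natDegree = n + 1 := natDegree_shiftedProd A _
  have hirr := irreducible_of_map_eq_X_pow hℓ hmonic hdeg n.succ_pos hmap h0
  have hirr' : Irreducible (f.map (Int.castRingHom ℚ)) :=
    (hmonic.irreducible_iff_irreducible_map_fraction_map (K := ℚ)).1 hirr
  have hdeg' : (f.map (Int.castRingHom ℚ)).natDegree = n + 1 := by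
    rw [hmonic.natDegree_map, hdeg]
  obtain ⟨z, hz⟩ := Complex.exists_root (f := f.map (Int.castRingHom ℂ)) (by
    rw [hmonic.degree_map, Polynomial.degree_eq_natDegree hmonic.ne_zero, hdeg]
    exact_mod_cast n.succ_pos)
  have hz' : Polynomial.aeval z (f.map (Int.castRingHom ℚ)) = 0 := by
    change Polynomial.aeval z (f.map (algebraMap ℤ ℚ)) = 0
    rw [Polynomial.aeval_map_algebraMap]
    rwa [Polynomial.IsRoot, Polynomial.eval_map] at hz
  have hmin : f.map (Int.castRingHom ℚ) = minpoly ℚ z :=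
    minpoly.eq_of_irreducible_of_monic hirr' hz' (hmonic.map _)
  have hint : IsIntegral ℚ z := ⟨_, hmonic.map _, hz'⟩
  let K := IntermediateField.adjoin ℚ {z}
  let pb : PowerBasis ℚ K := IntermediateField.adjoin.powerBasis hint
  have hpb : minpoly ℚ pb.gen = f.map (Int.castRingHom ℚ) := by
    rw [hmin, IntermediateField.adjoin.powerBasis_gen]
    exact IntermediateField.minpoly_gen ℚ z
  have hK : NumberField K := { to_charZero := inferInstance, to_finiteDimensional := pb.finite }
  have hfin : Module.finrank ℚ K = n + 1 := by
    rw [pb.finrank, ← pb.natDegree_minpoly, hpb, hdeg']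
  have hreal : InfinitePlace.nrRealPlaces K = r₁ := by
    rw [nrRealPlaces_eq_ncard pb, hpb, ← hcard]
    congr 1
    ext t
    change Polynomial.aeval t (f.map (algebraMap ℤ ℚ)) = 0 ↔ _
    rw [Polynomial.aeval_map_algebraMap]
    rfl
  obtain ⟨hcomplex, hrank⟩ := nrComplexPlaces_eq_and_rank_le n.succ_pos hsig hfin hreal
  have hroot : Polynomial.aeval pb.gen f = 0 := by
    rw [← Polynomial.aeval_map_algebraMap ℚ]
    change Polynomial.aeval pb.gen (f.map (Int.castRingHom ℚ)) = 0
    rw [← hpb, minpoly.aeval]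
  obtain ⟨θ, hθ⟩ : ∃ θ : 𝓞 K, algebraMap (𝓞 K) K θ = pb.gen := ⟨⟨pb.gen, f, hmonic, hroot⟩, rfl⟩
  have hdisc : (ℓ : ℤ) ∣ discr K := by
    refine dvd_discr_of_map_eq_X_pow hℓ (by omega) hmap h0 (θ := θ)
      (RingOfIntegers.coe_injective ?_)
    rw [← Polynomial.aeval_algebraMap_apply, map_zero, hθ, hroot]
  exact ⟨K.toSubfield, hK, ℓ, hL, hdisc, hfin, hreal, hcomplex,
    hA.exists_injective hm pb hpb hfin hrank⟩

/-- Let `m, d > 1` and let `r₁, r₂ ≥ 0` with `r₁ + 2r₂ = d`. There exist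
infinitely many isomorphism classes of number fields `k` of degree `d` with exactly `r₁` real
places and `r₂` complex places such that `rank_m Cl(k) ≥ r₂`. -/
theorem azuhata_ichimura (m d : ℕ) (hm : 1 < m) (hd : 1 < d)
    (r₁ r₂ : ℕ) (hsig : r₁ + 2 * r₂ = d) :
    ∃ S : Set (Subfield ℂ), S.Infinite ∧
      -- the fields in `S` are pairwise non-isomorphic
      (∀ K ∈ S, ∀ L ∈ S, Nonempty (↥K ≃+* ↥L) → K = L) ∧
      ∀ K ∈ S, NumberField ↥K ∧ Module.finrank ℚ ↥K = d ∧
        Nat.card {v : NumberField.InfinitePlace ↥K // v.IsReal} = r₁ ∧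
        Nat.card {v : NumberField.InfinitePlace ↥K // v.IsComplex} = r₂ ∧
        ∃ f : (Fin r₂ → ZMod m) →+ Additive (ClassGroup (𝓞 ↥K)),
          Function.Injective f := by
  obtain ⟨n, rfl⟩ : ∃ n, d = n + 1 := ⟨d - 1, by omega⟩
  choose K hK ℓ hℓ hdisc hfin hreal hcomplex hinj using
    exists_subfield_complex (zero_lt_one.trans hm) (show 0 < n by omega) hsig
  let D (L : ℕ) : ℤ := discr (K L)
  have hD (L : ℕ) : L < (D L).natAbs := (hℓ L).trans_le
    (Nat.le_of_dvd (Int.natAbs_pos.2 (discr_ne_zero _)) (Int.natCast_dvd.1 (hdisc L)))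
  have hrange : (Set.range D).Infinite := by
    intro h
    obtain ⟨B, hB⟩ := (h.image Int.natAbs).bddAbove
    exact (hD B).not_ge (hB ⟨_, ⟨B, rfl⟩, rfl⟩)
  obtain ⟨s, hs⟩ := Set.exists_image_eq_and_injOn Set.univ D
  rw [Set.image_univ] at hs
  have heq {i j : ℕ} (h : Nonempty (K i ≃+* K j)) : D i = D j :=
    discr_eq_discr_of_ringEquiv (K i) h.some
  have hKs : Set.InjOn K s := by
    intro i hi j hj h
    refine hs.2 hi hj (heq ⟨?_⟩)
    rw [h]
  refine ⟨K '' s, Set.Infinite.image hKs fun h => hrange (hs.1 ▸ h.image D), ?_, ?_⟩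
  · rintro _ ⟨i, hi, rfl⟩ _ ⟨j, hj, rfl⟩ h
    rw [hs.2 hi hj (heq h)]
  · rintro _ ⟨i, -, rfl⟩
    classical
    refine ⟨hK i, hfin i, ?_, ?_, hinj i⟩
    · rw [Nat.card_eq_fintype_card]
      exact hreal i
    · rw [Nat.card_eq_fintype_card]
      exact hcomplex i
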